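/- For every positive integer m, ∑_{r∈ℤ, r even} H(4m−r²) = (4/3)·σ₁(m) − 2·σ₁(m/2) + (8/3)·σ₁(m/4) − (1/2)·∑_{a,b∈ℤ, b²−a²=m} min(|a+b|, |a−b|), where both sums have only finitely many nonzero terms. -/

import Mathlib

/-!
STATEMENT 7: For every positive integer m,
∑_{r∈ℤ, r even} H(4m−r²) = (4/3)σ₁(m) − 2σ₁(m/2) + (8/3)σ₁(m/4)
  − (1/2)·∑_{a,b∈ℤ, b²−a²=m} min(|a+b|,|a−b|),
where σ₁(t)=0 if t is not a positive integer, and both sums have only finitely many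
nonzero terms.
-/

/-- Integral binary quadratic forms [a,b,c] are represented as triples (a,b,c) ∈ ℤ³,
with Q(x,y) = ax² + bxy + cy² and discriminant b² − 4ac. -/
def qfAct (g : Matrix.SpecialLinearGroup (Fin 2) ℤ) (Q : ℤ × ℤ × ℤ) : ℤ × ℤ × ℤ :=
  ((Q.1 * (g.1 0 0) ^ 2 + Q.2.1 * (g.1 0 0) * (g.1 0 1) + Q.2.2 * (g.1 0 1) ^ 2),
   (2 * Q.1 * (g.1 0 0) * (g.1 1 0) + Q.2.1 * ((g.1 0 0) * (g.1 1 1) + (g.1 0 1) * (g.1 1 0)) +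
      2 * Q.2.2 * (g.1 0 1) * (g.1 1 1)),
   (Q.1 * (g.1 1 0) ^ 2 + Q.2.1 * (g.1 1 0) * (g.1 1 1) + Q.2.2 * (g.1 1 1) ^ 2))

/-- SL₂(ℤ)-equivalence of integral binary quadratic forms. -/
def qfRel (Q₁ Q₂ : ℤ × ℤ × ℤ) : Prop := ∃ g : Matrix.SpecialLinearGroup (Fin 2) ℤ, qfAct g Q₁ = Q₂

/-- The set of SL₂(ℤ)-classes of positive definite integral binary quadratic forms of
discriminant −n. -/
def qfClasses (n : ℤ) : Set (Quot qfRel) :=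
  {q | ∃ Q : ℤ × ℤ × ℤ, Quot.mk qfRel Q = q ∧ Q.2.1 ^ 2 - 4 * Q.1 * Q.2.2 = -n ∧ 0 < Q.1}

/-- The Hurwitz class number H(n): H(0) = −1/12; for n > 0 with n ≡ 0, 3 (mod 4), H(n) is the
number of SL₂(ℤ)-classes of positive definite integral binary quadratic forms of discriminant
−n, where the class containing a multiple of x²+y² is counted with weight 1/2 and the class
containing a multiple of x²+xy+y² with weight 1/3; H(n) = 0 otherwise. -/
noncomputable def hurwitzH (n : ℤ) : ℝ :=
  if n = 0 then -(1 / 12)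
  else if 0 < n ∧ (n % 4 = 0 ∨ n % 4 = 3) then
    ((qfClasses n).ncard : ℝ)
      - 1 / 2 * (({q ∈ qfClasses n | ∃ k : ℤ, Quot.mk qfRel (k, 0, k) = q}).ncard : ℝ)
      - 2 / 3 * (({q ∈ qfClasses n | ∃ k : ℤ, Quot.mk qfRel (k, k, k) = q}).ncard : ℝ)
  else 0

/-- σ₁ extended to ℚ: σ₁(t) = ∑_{d∣t} d if t is a positive integer, and 0 otherwise. -/
noncomputable def sigma1Q (t : ℚ) : ℝ :=
  if t.den = 1 ∧ 0 < t.num then ∑ d ∈ t.num.toNat.divisors, (d : ℝ) else 0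

/-- A sign-valued weight on quadruples whose sum over the solutions of
`s ^ 2 + p q + q t + t p = ± m` can be evaluated by an involution and by symmetrization. -/
def psi (s p q t : ℤ) : ℤ :=
  3 * (s.sign * t.sign) * ((s + t).sign * (p + t).sign + (s - t).sign * (q + t).sign)
    + ((s + t).sign * (p + t).sign - (s - t).sign * (q + t).sign
    - 2 * ((s - q).sign * (s + p).sign))

/-- Four on positive triples, two on nonnegative triples with exactly one vanishing entry. -/
def triWt (p q t : ℤ) : ℤ :=
  if 0 ≤ p ∧ 0 ≤ q ∧ 0 ≤ t ∧ 0 < p * q + q * t + t * p then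
    if p = 0 ∨ q = 0 ∨ t = 0 then 2 else 4
  else 0

lemma sign_cases {x : ℤ} (hx : x ≠ 0) : (0 < x ∧ x.sign = 1) ∨ (x < 0 ∧ x.sign = -1) := by
  rcases lt_or_gt_of_ne hx with h | h
  · exact Or.inr ⟨h, Int.sign_eq_neg_one_of_neg h⟩
  · exact Or.inl ⟨h, Int.sign_eq_one_of_pos h⟩

lemma sign_cases3 (x : ℤ) :
    (0 < x ∧ x.sign = 1) ∨ (x = 0 ∧ x.sign = 0) ∨ (x < 0 ∧ x.sign = -1) := by
  rcases lt_trichotomy x 0 with h | h | h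
  · exact Or.inr (Or.inr ⟨h, Int.sign_eq_neg_one_of_neg h⟩)
  · exact Or.inr (Or.inl ⟨h, by simp [h]⟩)
  · exact Or.inl ⟨h, Int.sign_eq_one_of_pos h⟩

/-- `y` is the sign of the nonzero integer `x`. -/
def IsSign (x y : ℤ) : Prop := x ≠ 0 ∧ x.sign = y

lemma IsSign.cases {x y : ℤ} (h : IsSign x y) : (0 < x ∧ y = 1) ∨ (x < 0 ∧ y = -1) := by
  obtain ⟨h, rfl⟩ := h
  exact sign_cases h

/-- `y` is the sign of the integer `x`. -/
def IsSign0 (x y : ℤ) : Prop := x.sign = y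

lemma IsSign0.cases {x y : ℤ} (h : IsSign0 x y) :
    (0 < x ∧ y = 1) ∨ (x = 0 ∧ y = 0) ∨ (x < 0 ∧ y = -1) := by
  obtain rfl := h
  exact sign_cases3 x

/-- For signs `x, y, z, w`: the products `x * y` and `z * w` are not both negative. -/
def notBothNeg (x y z w : ℤ) : Bool := ! decide (x * y = -1 ∧ z * w = -1)

lemma sign_of_pos {x y z w : ℤ} (h : 0 < x * y + z * w) :
    notBothNeg x.sign y.sign z.sign w.sign = true := by
  simp only [notBothNeg, Bool.not_eq_true', decide_eq_false_iff_not]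
  rintro ⟨h1, h2⟩
  rw [← Int.sign_mul] at h1 h2
  rw [Int.sign_eq_neg_one_iff_neg] at h1 h2
  omega

/-- The weight `triWt` of a triple or of its negative, in terms of the signs of the entries. -/
def signWt (x y z : ℤ) : ℤ :=
  if |x + y + z| = 3 then 4 else if |x + y + z| = 2 then 2 else 0

lemma psi_neg (s p q t : ℤ) : psi (-s) (-p) (-q) (-t) = psi s p q t := by
  have h (x y : ℤ) : -x + -y = -(x + y) := by ring
  have h' (x y : ℤ) : -x - -y = -(x - y) := by ring
  simp only [psi, h, h', Int.sign_neg]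
  ring

set_option maxHeartbeats 2000000 in
lemma psi_aux {s p q t : ℤ} (hs : 0 ≤ s)
    (h1 : s + p ≠ 0) (h2 : s - p ≠ 0) (h3 : s + q ≠ 0) (h4 : s - q ≠ 0) (h5 : s + t ≠ 0)
    (h6 : s - t ≠ 0) (h7 : p + q ≠ 0) (h8 : q + t ≠ 0) (h9 : p + t ≠ 0) :
    (0 < s ^ 2 + p * q + q * t + t * p →
      psi s p q t + psi s q t p + psi s t p q = 3 * signWt p.sign q.sign t.sign) ∧
    (0 < -(s ^ 2 + p * q + q * t + t * p) →
      psi s p q t + psi s q t p + psi s t p q = 0) := by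
  have key : ∀ ε : ℤ, (ε = 1 ∨ ε = -1) → 0 < ε * (s ^ 2 + p * q + q * t + t * p) →
      psi s p q t + psi s q t p + psi s t p q =
        if ε = 1 then 3 * signWt p.sign q.sign t.sign else 0 := by
    intro ε hε h
    have e0 : ε.sign = ε := by rcases hε with rfl | rfl <;> rfl
    have e1 := @sign_of_pos (ε*(s+p)) (s-p) (ε*(p+q)) (p+t) (by linarith)
    have e2 := @sign_of_pos (ε*(s+q)) (s-q) (ε*(p+q)) (q+t) (by linarith)
    have e3 := @sign_of_pos (ε*(s+t)) (s-t) (ε*(p+t)) (q+t) (by linarith)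
    have e4 := @sign_of_pos (ε*(s+p)) (s+t) (ε*-(p+t)) (s-q) (by linarith)
    have e5 := @sign_of_pos (ε*(s+p)) (s+q) (ε*-(p+q)) (s-t) (by linarith)
    have e6 := @sign_of_pos (ε*(s+q)) (s+t) (ε*-(q+t)) (s-p) (by linarith)
    have e7 := @sign_of_pos (ε*(s-p)) (s-t) (ε*(p+t)) (s+q) (by linarith)
    have e8 := @sign_of_pos (ε*(s-p)) (s-q) (ε*(p+q)) (s+t) (by linarith)
    have e9 := @sign_of_pos (ε*(s-q)) (s-t) (ε*(q+t)) (s+p) (by linarith)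
    clear h
    simp only [Int.sign_neg, Int.sign_mul, e0] at e1 e2 e3 e4 e5 e6 e7 e8 e9
    clear e0
    simp only [psi, add_comm q p, add_comm t p, add_comm t q]
    have c1 : IsSign (s+p) _ := ⟨h1, rfl⟩
    have c2 : IsSign (s-p) _ := ⟨h2, rfl⟩
    have c3 : IsSign (s+q) _ := ⟨h3, rfl⟩
    have c4 : IsSign (s-q) _ := ⟨h4, rfl⟩
    have c5 : IsSign (s+t) _ := ⟨h5, rfl⟩
    have c6 : IsSign (s-t) _ := ⟨h6, rfl⟩
    have c7 : IsSign (p+q) _ := ⟨h7, rfl⟩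
    have c8 : IsSign (q+t) _ := ⟨h8, rfl⟩
    have c9 : IsSign (p+t) _ := ⟨h9, rfl⟩
    have d0 : IsSign0 s _ := rfl
    have d1 : IsSign0 p _ := rfl
    have d2 : IsSign0 q _ := rfl
    have d3 : IsSign0 t _ := rfl
    clear h1 h2 h3 h4 h5 h6 h7 h8 h9
    generalize (s+p).sign = x1 at *
    generalize (s-p).sign = x2 at *
    generalize (s+q).sign = x3 at *
    generalize (s-q).sign = x4 at *
    generalize (s+t).sign = x5 at *
    generalize (s-t).sign = x6 at *
    generalize (p+q).sign = x7 at *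
    generalize (q+t).sign = x8 at *
    generalize (p+t).sign = x9 at *
    generalize s.sign = y0 at *
    generalize p.sign = y1 at *
    generalize q.sign = y2 at *
    generalize t.sign = y3 at *
    (rcases c1.cases with ⟨h1, rfl⟩ | ⟨h1, rfl⟩) <;>
    (rcases c2.cases with ⟨h2, rfl⟩ | ⟨h2, rfl⟩ <;> try omega) <;>
    (rcases c3.cases with ⟨h3, rfl⟩ | ⟨h3, rfl⟩) <;>
    (rcases c4.cases with ⟨h4, rfl⟩ | ⟨h4, rfl⟩ <;> try omega) <;>
    (rcases c5.cases with ⟨h5, rfl⟩ | ⟨h5, rfl⟩) <;>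
    (rcases c6.cases with ⟨h6, rfl⟩ | ⟨h6, rfl⟩ <;> try omega) <;>
    (rcases c7.cases with ⟨h7, rfl⟩ | ⟨h7, rfl⟩ <;> try omega) <;>
    (rcases c8.cases with ⟨h8, rfl⟩ | ⟨h8, rfl⟩ <;> try omega) <;>
    (rcases c9.cases with ⟨h9, rfl⟩ | ⟨h9, rfl⟩ <;> try omega) <;>
    (rcases hε with rfl | rfl) <;>
    (try (exfalso; revert e1 e2 e3 e4 e5 e6 e7 e8 e9; decide +kernel)) <;>
    (rcases d0.cases with ⟨h, rfl⟩ | ⟨h, rfl⟩ | ⟨h, rfl⟩ <;> try omega) <;>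
    (rcases d1.cases with ⟨h', rfl⟩ | ⟨h', rfl⟩ | ⟨h', rfl⟩ <;> try omega) <;>
    (rcases d2.cases with ⟨h'', rfl⟩ | ⟨h'', rfl⟩ | ⟨h'', rfl⟩ <;> try omega) <;>
    (rcases d3.cases with ⟨h''', rfl⟩ | ⟨h''', rfl⟩ | ⟨h''', rfl⟩ <;> try omega) <;>
    decide +kernel
  constructor
  · intro h
    simpa using key 1 (Or.inl rfl) (by linarith)
  · intro h
    simpa using key (-1) (Or.inr rfl) (by linarith)

/-- Integer quadruples `(s, p, q, t)` in a box on which the form takes the values `±m`. -/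
noncomputable def boxSol (m : ℤ) : Finset (ℤ × ℤ × ℤ × ℤ) :=
  {v ∈ Finset.Icc (-(3 * m)) (3 * m) ×ˢ Finset.Icc (-(3 * m)) (3 * m) ×ˢ
      Finset.Icc (-(3 * m)) (3 * m) ×ˢ Finset.Icc (-(3 * m)) (3 * m) |
    v.1 ^ 2 + v.2.1 * v.2.2.1 + v.2.2.1 * v.2.2.2 + v.2.2.2 * v.2.1 = m ∨
    v.1 ^ 2 + v.2.1 * v.2.2.1 + v.2.2.1 * v.2.2.2 + v.2.2.2 * v.2.1 = -m}

lemma mem_boxSol {m s p q t : ℤ} : (s, p, q, t) ∈ boxSol m ↔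
    ((-(3 * m) ≤ s ∧ s ≤ 3 * m) ∧ (-(3 * m) ≤ p ∧ p ≤ 3 * m) ∧ (-(3 * m) ≤ q ∧ q ≤ 3 * m) ∧
      (-(3 * m) ≤ t ∧ t ≤ 3 * m)) ∧
    (s ^ 2 + p * q + q * t + t * p = m ∨ s ^ 2 + p * q + q * t + t * p = -m) := by
  simp [boxSol]

/-- The six linear forms preserved up to sign by the basic involution do not vanish. -/
def Reg (v : ℤ × ℤ × ℤ × ℤ) : Prop :=
  v.1 + v.2.2.2 ≠ 0 ∧ v.1 - v.2.2.2 ≠ 0 ∧ v.2.1 + v.2.2.2 ≠ 0 ∧ v.2.2.1 + v.2.2.2 ≠ 0 ∧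
    v.1 - v.2.2.1 ≠ 0 ∧ v.1 + v.2.1 ≠ 0

/-- None of the nine linear forms vanishes. -/
def Full (v : ℤ × ℤ × ℤ × ℤ) : Prop :=
  Reg v ∧ v.1 - v.2.1 ≠ 0 ∧ v.1 + v.2.2.1 ≠ 0 ∧ v.2.1 + v.2.2.1 ≠ 0

instance : DecidablePred Reg := fun v => by unfold Reg; infer_instance
instance : DecidablePred Full := fun v => by unfold Full; infer_instance

/-- `psi` as a function of a quadruple. -/
def psi' (v : ℤ × ℤ × ℤ × ℤ) : ℤ := psi v.1 v.2.1 v.2.2.1 v.2.2.2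

lemma psi_rot (s p q t : ℤ) : psi t (-p - t - s) (q + t - s) s = - psi s p q t := by
  have h1 : t + s = s + t := by ring
  have h2 : -p - t - s + s = -(p + t) := by ring
  have h3 : q + t - s + s = q + t := by ring
  have h4 : t - (q + t - s) = s - q := by ring
  have h5 : t + (-p - t - s) = -(s + p) := by ring
  have h6 : t - s = -(s - t) := by ring
  simp only [psi, h1, h2, h3, h4, h5, h6, Int.sign_neg]
  ring

lemma abs_le_of_sign_eq {m X Y Z W : ℤ} (hm0 : 0 ≤ m) (hX : X ≠ 0) (hY : Y ≠ 0)
    (hZ : Z ≠ 0) (hW : W ≠ 0)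
    (h : X.sign * Y.sign = Z.sign * W.sign) (hm : X * Z + Y * W = m ∨ X * Z + Y * W = -m) :
    |X| ≤ m ∧ |Y| ≤ m ∧ |Z| ≤ m ∧ |W| ≤ m := by
  have key : |X| * |Z| + |Y| * |W| = |m| := by
    have : |m| = |X * Z + Y * W| := by rcases hm with h | h <;> rw [h] ; rw [abs_neg]
    rw [this, ← abs_mul, ← abs_mul]
    have : 0 ≤ (X * Z) * (Y * W) := by
      have : (X * Z * (Y * W)).sign = 1 := by
        have e : X * Z * (Y * W) = (X * Y) * (Z * W) := by ring
        rw [e, Int.sign_mul, Int.sign_mul, Int.sign_mul, h]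
        rcases sign_cases hZ with ⟨_, h1⟩ | ⟨_, h1⟩ <;>
        rcases sign_cases hW with ⟨_, h2⟩ | ⟨_, h2⟩ <;>
          simp [h1, h2]
      exact (Int.sign_eq_one_iff_pos.1 this).le
    rw [eq_comm, abs_add_eq_add_abs_iff]
    rcases le_or_gt 0 (X * Z) with h1 | h1 <;> rcases le_or_gt 0 (Y * W) with h2 | h2
    · exact Or.inl ⟨h1, h2⟩
    · rcases h1.eq_or_lt with h1 | h1
      · exact Or.inr ⟨h1.symm.le, h2.le⟩
      · nlinarith
    · rcases h2.eq_or_lt with h2 | h2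
      · exact Or.inr ⟨h1.le, h2.symm.le⟩
      · nlinarith
    · exact Or.inr ⟨h1.le, h2.le⟩
  have key2 : |X| * |Z| + |Y| * |W| = m := by
    rw [key, abs_of_nonneg hm0]
  have hX' := Int.one_le_abs hX
  have hY' := Int.one_le_abs hY
  have hZ' := Int.one_le_abs hZ
  have hW' := Int.one_le_abs hW
  refine ⟨?_, ?_, ?_, ?_⟩ <;> nlinarith

lemma psi_bound {m s p q t : ℤ} (hm0 : 0 ≤ m) (hr : Reg (s, p, q, t)) (hp : psi s p q t ≠ 0)
    (hm : s ^ 2 + p * q + q * t + t * p = m ∨ s ^ 2 + p * q + q * t + t * p = -m) :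
    (s, p, q, t) ∈ boxSol m := by
  obtain ⟨h1, h2, h3, h4, h5, h6⟩ := hr
  simp only at h1 h2 h3 h4 h5 h6
  rw [mem_boxSol]
  refine ⟨?_, hm⟩
  have hc : (s + t).sign * (p + t).sign = (s - t).sign * (q + t).sign ∨
      (s + t).sign * (p + t).sign = (s + p).sign * (q - s).sign ∨
      (s - t).sign * (q + t).sign = (s - q).sign * (s + p).sign := by
    by_contra! hcon
    apply hp
    obtain ⟨c1, c2, c3⟩ := hcon
    have e : q - s = -(s - q) := by ring
    rw [e, Int.sign_neg] at c2
    unfold psi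
    generalize s.sign * t.sign = k
    have g1 := sign_cases h1
    have g2 := sign_cases h2
    have g3 := sign_cases h3
    have g4 := sign_cases h4
    have g5 := sign_cases h5
    have g6 := sign_cases h6
    have r1 : (s + t).sign * (p + t).sign = 1 ∨ (s + t).sign * (p + t).sign = -1 := by
      rcases g1 with ⟨_, e⟩ | ⟨_, e⟩ <;> rcases g3 with ⟨_, e'⟩ | ⟨_, e'⟩ <;> simp [e, e']
    have r2 : (s - t).sign * (q + t).sign = 1 ∨ (s - t).sign * (q + t).sign = -1 := by
      rcases g2 with ⟨_, e⟩ | ⟨_, e⟩ <;> rcases g4 with ⟨_, e'⟩ | ⟨_, e'⟩ <;> simp [e, e']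
    have r3 : (s - q).sign * (s + p).sign = 1 ∨ (s - q).sign * (s + p).sign = -1 := by
      rcases g5 with ⟨_, e⟩ | ⟨_, e⟩ <;> rcases g6 with ⟨_, e'⟩ | ⟨_, e'⟩ <;> simp [e, e']
    have c2' : (s + t).sign * (p + t).sign ≠ - ((s - q).sign * (s + p).sign) := by
      intro h; apply c2; rw [h]; ring
    have e : (s + t).sign * (p + t).sign = - ((s - t).sign * (q + t).sign) := by omega
    rw [e]
    have : k * 3 * (-((s - t).sign * (q + t).sign) + (s - t).sign * (q + t).sign) = 0 := by ring
    have e2 : (s - q).sign * (s + p).sign = - ((s - t).sign * (q + t).sign) := by omega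
    rw [e2]; ring
  have b : ∀ x : ℤ, |x| ≤ m ↔ -m ≤ x ∧ x ≤ m := fun x => abs_le
  rcases hc with hc | hc | hc
  · obtain ⟨k1, k2, k3, k4⟩ := abs_le_of_sign_eq hm0 h1 h3 h2 h4 hc
      (by rcases hm with h | h <;> [left; right] <;> rw [← h] <;> ring)
    rw [b] at k1 k2 k3 k4
    omega
  · obtain ⟨k1, k2, k3, k4⟩ := abs_le_of_sign_eq hm0 h1 h3 h6 (W := q - s) (by omega) hc
      (by rcases hm with h | h <;> [left; right] <;> rw [← h] <;> ring)
    rw [b] at k1 k2 k3 k4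
    omega
  · obtain ⟨k1, k2, k3, k4⟩ := abs_le_of_sign_eq hm0 h2 h4 h5 h6 hc
      (by rcases hm with h | h <;> [left; right] <;> rw [← h] <;> ring)
    rw [b] at k1 k2 k3 k4
    omega

lemma sum_psi_reg {m : ℤ} (hm : 0 < m) : ∑ v ∈ boxSol m with Reg v, psi' v = 0 := by
  rw [← Finset.sum_filter_ne_zero]
  refine Finset.sum_involution
    (fun v _ => (v.2.2.2, -v.2.1 - v.2.2.2 - v.1, v.2.2.1 + v.2.2.2 - v.1, v.1)) ?_ ?_ ?_ ?_
  · rintro ⟨s, p, q, t⟩ -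
    simp [psi', psi_rot]
  · rintro ⟨s, p, q, t⟩ hv -
    rw [Finset.mem_filter, Finset.mem_filter] at hv
    simp only [Reg] at hv
    simp only [ne_eq, Prod.mk.injEq]
    omega
  · rintro ⟨s, p, q, t⟩ hv
    simp only [Finset.mem_filter, mem_boxSol] at hv
    obtain ⟨⟨⟨-, hQ⟩, hr⟩, hp⟩ := hv
    have hr' : Reg (t, -p - t - s, q + t - s, s) := by
      simp only [Reg] at hr ⊢
      omega
    have hp' : psi t (-p - t - s) (q + t - s) s ≠ 0 := by
      rw [psi_rot]; simpa [psi'] using hp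
    simp only [Finset.mem_filter]
    refine ⟨⟨psi_bound hm.le hr' hp' ?_, hr'⟩, hp'⟩
    rcases hQ with h | h <;> [right; left] <;> linear_combination -h
  · rintro ⟨s, p, q, t⟩ -
    simp only [Prod.mk.injEq, true_and, and_true]
    constructor <;> ring

lemma sum_psi_split {m : ℤ} (hm : 0 < m) :
    ∑ v ∈ boxSol m with Full v, psi' v
      + ∑ v ∈ boxSol m with Reg v ∧ v.1 = v.2.1, psi' v
      + ∑ v ∈ boxSol m with Reg v ∧ v.1 = -v.2.2.1, psi' v
      + ∑ v ∈ boxSol m with Reg v ∧ v.2.1 = -v.2.2.1, psi' v = 0 := by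
  rw [← sum_psi_reg hm]
  simp only [Finset.sum_filter]
  simp only [← Finset.sum_add_distrib]
  refine Finset.sum_congr rfl ?_
  rintro ⟨s, p, q, t⟩ hv
  rw [mem_boxSol] at hv
  by_cases hr : Reg (s, p, q, t)
  · have h12 : ¬ (s = p ∧ s = -q) := by
      rintro ⟨rfl, h⟩
      obtain rfl : q = -s := by omega
      rcases hv.2 with h | h <;> ring_nf at h <;> omega
    by_cases h1 : s = p <;> by_cases h2 : s = -q <;> by_cases h3 : p = -q <;>
      simp only [hr, Full, h1, h2, h3] <;> (try simp) <;> (try omega)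
  · simp [hr, Full]

lemma sum_psi_full_rot (m : ℤ) :
    ∑ v ∈ boxSol m with Full v, psi' v =
      ∑ v ∈ boxSol m with Full v, psi' (v.1, v.2.2.1, v.2.2.2, v.2.1) := by
  refine Finset.sum_nbij' (fun v => (v.1, v.2.2.2, v.2.1, v.2.2.1))
    (fun v => (v.1, v.2.2.1, v.2.2.2, v.2.1)) ?_ ?_ ?_ ?_ ?_
  · rintro ⟨s, p, q, t⟩ hv
    rw [Finset.mem_filter, mem_boxSol] at hv ⊢
    simp only [Full, Reg] at hv ⊢
    refine ⟨⟨by omega, ?_⟩, by omega⟩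
    rcases hv.1.2 with h | h <;> [left; right] <;> linear_combination h
  · rintro ⟨s, p, q, t⟩ hv
    rw [Finset.mem_filter, mem_boxSol] at hv ⊢
    simp only [Full, Reg] at hv ⊢
    refine ⟨⟨by omega, ?_⟩, by omega⟩
    rcases hv.1.2 with h | h <;> [left; right] <;> linear_combination h
  · rintro ⟨s, p, q, t⟩ -; rfl
  · rintro ⟨s, p, q, t⟩ -; rfl
  · rintro ⟨s, p, q, t⟩ -; rfl

lemma signWt_eq {p q t : ℤ} (h : p + q ≠ 0) (h' : q + t ≠ 0) (h'' : p + t ≠ 0) :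
    signWt p.sign q.sign t.sign = triWt p q t + triWt (-p) (-q) (-t) := by
  have pos {x y z : ℤ} (hx : 0 ≤ x) (hy : 0 ≤ y) (hz : 0 ≤ z) (h : x + y ≠ 0) (h' : y + z ≠ 0)
      (h'' : x + z ≠ 0) : 0 < x * y + y * z + z * x := by
    rcases hx.eq_or_lt with rfl | hx
    · have : 0 < y := by omega
      have : 0 < z := by omega
      nlinarith [mul_pos ‹0 < y› ‹0 < z›]
    · rcases hy.eq_or_lt with rfl | hy
      · have : 0 < z := by omega
        nlinarith [mul_pos ‹0 < x› ‹0 < z›]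
      · nlinarith [mul_pos hx hy, mul_nonneg hy.le hz, mul_nonneg hz hx.le]
  have e1 : triWt p q t = if 0 ≤ p ∧ 0 ≤ q ∧ 0 ≤ t then
      if p = 0 ∨ q = 0 ∨ t = 0 then 2 else 4 else 0 := by
    unfold triWt
    congr 1
    exact propext ⟨fun ⟨a, b, c, _⟩ => ⟨a, b, c⟩, fun ⟨a, b, c⟩ => ⟨a, b, c, pos a b c h h' h''⟩⟩
  have e2 : triWt (-p) (-q) (-t) = if p ≤ 0 ∧ q ≤ 0 ∧ t ≤ 0 then
      if p = 0 ∨ q = 0 ∨ t = 0 then 2 else 4 else 0 := by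
    unfold triWt
    simp only [Left.nonneg_neg_iff, neg_eq_zero]
    congr 1
    exact propext ⟨fun ⟨a, b, c, _⟩ => ⟨a, b, c⟩, fun ⟨a, b, c⟩ => ⟨a, b, c,
      pos (x := -p) (y := -q) (z := -t) (by omega) (by omega) (by omega) (by omega)
        (by omega) (by omega)⟩⟩
  rw [e1, e2]
  rcases sign_cases3 p with ⟨hp, ep⟩ | ⟨hp, ep⟩ | ⟨hp, ep⟩ <;>
  rcases sign_cases3 q with ⟨hq, eq⟩ | ⟨hq, eq⟩ | ⟨hq, eq⟩ <;>
  rcases sign_cases3 t with ⟨ht, et⟩ | ⟨ht, et⟩ | ⟨ht, et⟩ <;>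
  rw [ep, eq, et, signWt] <;> norm_num <;> (try split_ifs) <;> omega

lemma psi_sum_eq {m s p q t : ℤ} (hm : 0 < m) (hf : Full (s, p, q, t))
    (hQ : s ^ 2 + p * q + q * t + t * p = m ∨ s ^ 2 + p * q + q * t + t * p = -m) :
    psi s p q t + psi s q t p + psi s t p q =
      if s ^ 2 + p * q + q * t + t * p = m then
          3 * (triWt p q t + triWt (-p) (-q) (-t)) else 0 := by
  obtain ⟨⟨h1, h2, h3, h4, h5, h6⟩, h7, h8, h9⟩ := hf
  simp only at h1 h2 h3 h4 h5 h6 h7 h8 h9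
  rw [← signWt_eq h9 h4 h3]
  have key : (0 < s ^ 2 + p * q + q * t + t * p →
      psi s p q t + psi s q t p + psi s t p q = 3 * signWt p.sign q.sign t.sign) ∧
    (0 < -(s ^ 2 + p * q + q * t + t * p) →
      psi s p q t + psi s q t p + psi s t p q = 0) := by
    rcases le_total 0 s with hs | hs
    · exact psi_aux hs h6 h7 h8 h5 h1 h2 h9 h4 h3
    · have := @psi_aux (-s) (-p) (-q) (-t) (by omega) (by omega) (by omega) (by omega) (by omega)
        (by omega) (by omega) (by omega) (by omega) (by omega)
      simp only [psi_neg] at this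
      have e : (-s) ^ 2 + -p * -q + -q * -t + -t * -p = s ^ 2 + p * q + q * t + t * p := by ring
      have e' : signWt (-p).sign (-q).sign (-t).sign = signWt p.sign q.sign t.sign := by
        simp only [Int.sign_neg, signWt]
        have : -p.sign + -q.sign + -t.sign = -(p.sign + q.sign + t.sign) := by ring
        rw [this, abs_neg]
      rwa [e, e'] at this
  rcases hQ with h | h
  · rw [if_pos h, key.1 (by omega)]
  · rw [if_neg (by omega), key.2 (by omega)]

/-- Weighted sum over the generic solutions. -/
lemma sum_psi_full {m : ℤ} (hm : 0 < m) :
    ∑ v ∈ boxSol m with Full v, psi' v =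
      2 * ∑ v ∈ boxSol m with Full v ∧
        v.1 ^ 2 + v.2.1 * v.2.2.1 + v.2.2.1 * v.2.2.2 + v.2.2.2 * v.2.1 = m,
          triWt v.2.1 v.2.2.1 v.2.2.2 := by
  have h1 := sum_psi_full_rot m
  have h2 : ∑ v ∈ boxSol m with Full v, psi' v =
      ∑ v ∈ boxSol m with Full v, psi' (v.1, v.2.2.2, v.2.1, v.2.2.1) := by
    refine Finset.sum_nbij' (fun v => (v.1, v.2.2.1, v.2.2.2, v.2.1))
      (fun v => (v.1, v.2.2.2, v.2.1, v.2.2.1)) ?_ ?_ ?_ ?_ ?_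
    · rintro ⟨s, p, q, t⟩ hv
      rw [Finset.mem_filter, mem_boxSol] at hv ⊢
      simp only [Full, Reg] at hv ⊢
      refine ⟨⟨by omega, ?_⟩, by omega⟩
      rcases hv.1.2 with h | h <;> [left; right] <;> linear_combination h
    · rintro ⟨s, p, q, t⟩ hv
      rw [Finset.mem_filter, mem_boxSol] at hv ⊢
      simp only [Full, Reg] at hv ⊢
      refine ⟨⟨by omega, ?_⟩, by omega⟩
      rcases hv.1.2 with h | h <;> [left; right] <;> linear_combination h
    · rintro ⟨s, p, q, t⟩ -; rfl
    · rintro ⟨s, p, q, t⟩ -; rfl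
    · rintro ⟨s, p, q, t⟩ -; rfl
  have h3 : 3 * ∑ v ∈ boxSol m with Full v, psi' v =
      ∑ v ∈ boxSol m with Full v,
        if v.1 ^ 2 + v.2.1 * v.2.2.1 + v.2.2.1 * v.2.2.2 + v.2.2.2 * v.2.1 = m then
          3 * (triWt v.2.1 v.2.2.1 v.2.2.2 + triWt (-v.2.1) (-v.2.2.1) (-v.2.2.2)) else 0 := by
    rw [show 3 * ∑ v ∈ boxSol m with Full v, psi' v =
      ∑ v ∈ boxSol m with Full v, psi' v + ∑ v ∈ boxSol m with Full v, psi' v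
        + ∑ v ∈ boxSol m with Full v, psi' v by ring]
    nth_rw 2 [h1]
    nth_rw 2 [h2]
    rw [← Finset.sum_add_distrib, ← Finset.sum_add_distrib]
    refine Finset.sum_congr rfl ?_
    rintro ⟨s, p, q, t⟩ hv
    rw [Finset.mem_filter, mem_boxSol] at hv
    exact psi_sum_eq hm hv.2 hv.1.2
  have h4 : ∑ v ∈ boxSol m with Full v ∧
      v.1 ^ 2 + v.2.1 * v.2.2.1 + v.2.2.1 * v.2.2.2 + v.2.2.2 * v.2.1 = m,
        triWt (-v.2.1) (-v.2.2.1) (-v.2.2.2) = ∑ v ∈ boxSol m with Full v ∧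
      v.1 ^ 2 + v.2.1 * v.2.2.1 + v.2.2.1 * v.2.2.2 + v.2.2.2 * v.2.1 = m,
        triWt v.2.1 v.2.2.1 v.2.2.2 := by
    have hmem : ∀ v : ℤ × ℤ × ℤ × ℤ, v ∈ {v ∈ boxSol m | Full v ∧
        v.1 ^ 2 + v.2.1 * v.2.2.1 + v.2.2.1 * v.2.2.2 + v.2.2.2 * v.2.1 = m} → -v ∈
        {v ∈ boxSol m | Full v ∧
        v.1 ^ 2 + v.2.1 * v.2.2.1 + v.2.2.1 * v.2.2.2 + v.2.2.2 * v.2.1 = m} := by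
      rintro ⟨s, p, q, t⟩ hv
      rw [Prod.neg_mk, Prod.neg_mk, Prod.neg_mk]
      rw [Finset.mem_filter, mem_boxSol] at hv ⊢
      simp only [Full, Reg] at hv ⊢
      refine ⟨⟨by omega, Or.inl ?_⟩, by omega, ?_⟩ <;> linear_combination hv.2.2
    exact Finset.sum_nbij' (fun v => -v) (fun v => -v) hmem hmem (by simp) (by simp) (by simp)
  rw [← Finset.sum_filter, Finset.filter_filter, ← Finset.mul_sum, Finset.sum_add_distrib, h4] at h3
  linarith

lemma sum_sign_eq (K : ℕ) (k : ℤ) (hk : |k| ≤ 2 * K + 1) :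
    ∑ t ∈ Finset.Icc (-(K : ℤ)) K, (2 * t - k).sign = -k := by
  have tel : ∀ (n : ℕ) (c : ℤ), ∑ i ∈ Finset.range n, (2 * (c + i) - k).sign * 2 =
      |2 * (c + n) - k - 1| - |2 * c - k - 1| := by
    intro n c
    induction n with
    | zero => simp
    | succ n ih =>
      rw [Finset.sum_range_succ, ih]
      push_cast
      rcases sign_cases3 (2 * (c + n) - k) with ⟨h, e⟩ | ⟨h, e⟩ | ⟨h, e⟩ <;> rw [e] <;>
        rcases abs_cases (2 * (c + (n + 1)) - k - 1) with ⟨h1, h3⟩ | ⟨h1, h3⟩ <;>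
        rcases abs_cases (2 * (c + n) - k - 1) with ⟨h2, h4⟩ | ⟨h2, h4⟩ <;>
        rw [h1, h2] <;> omega
  have himg : Finset.Icc (-(K : ℤ)) K =
      (Finset.range (2 * K + 1)).image (fun i : ℕ => -(K : ℤ) + i) := by
    ext x
    simp only [Finset.mem_Icc, Finset.mem_image, Finset.mem_range]
    constructor
    · intro h
      exact ⟨(x + K).toNat, by omega, by omega⟩
    · rintro ⟨a, ha, rfl⟩
      omega
  rw [himg, Finset.sum_image (fun a _ b _ h => by simpa using h)]
  have := tel (2 * K + 1) (-(K : ℤ))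
  rw [← Finset.sum_mul] at this
  push_cast at this
  rw [abs_le] at hk
  rw [abs_of_nonneg (by omega), abs_of_nonpos (by omega)] at this
  omega

lemma sum_ite_eq_one (K : ℕ) (c : ℤ) (hc : |c| ≤ K) :
    ∑ t ∈ Finset.Icc (-(K : ℤ)) K, (if t = c then 1 else 0 : ℤ) = 1 := by
  rw [Finset.sum_ite_eq', if_pos]
  rwa [Finset.mem_Icc, ← abs_le]

lemma sum_ite_two_mul_eq (K : ℕ) (c : ℤ) (hc : |c| ≤ 2 * K) :
    ∑ t ∈ Finset.Icc (-(K : ℤ)) K, (if 2 * t = c then 1 else 0 : ℤ) = if 2 ∣ c then 1 else 0 := by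
  rw [abs_le] at hc
  split_ifs with h
  · obtain ⟨d, rfl⟩ := h
    refine Eq.trans ?_ (sum_ite_eq_one K d (by rw [abs_le]; omega))
    refine Finset.sum_congr rfl fun t _ => ?_
    simp
  · refine Finset.sum_eq_zero fun t _ => if_neg fun h' => h ⟨t, h'.symm⟩

/-- The value of `psi` on the locus `s = p`, where `e = s + t` and `f = p + q`. -/
def gU (e f t : ℤ) : ℤ :=
  if t = e ∨ 2 * t = e ∨ 2 * t = e - f ∨ 2 * t = 2 * e - f then 0 else
    -3 * (t - e).sign * t.sign * (1 - (2 * t - e).sign * (2 * t - (e - f)).sign)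
      + 1 + (2 * t - e).sign * (2 * t - (e - f)).sign
      - 2 * (2 * t - (2 * e - f)).sign * (t - e).sign

/-- The value of `psi` on the locus `p = -q`. -/
def gW (s q t : ℤ) : ℤ :=
  if t = s ∨ t = -s ∨ t = q ∨ t = -q then 0 else
    3 * s.sign * t.sign * ((t + s).sign * (t - q).sign - (t - s).sign * (t + q).sign)
      + (t + s).sign * (t - q).sign + (t - s).sign * (t + q).sign - 2

lemma sign_two_mul_sub (t e : ℤ) : (2 * t - 2 * e).sign = (t - e).sign := by
  rw [show 2 * t - 2 * e = 2 * (t - e) by ring, Int.sign_mul, show (2 : ℤ).sign = 1 from rfl,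
    one_mul]

lemma gU_pos_lt {e f : ℤ} (hf : 0 < f) (h : f < e) (t : ℤ) :
    gU e f t = 2 * (2 * t - (e - f)).sign - 2 * (2 * t - e).sign
      + 2 * (2 * t - (2 * e - f)).sign - 2 * (2 * t - 2 * e).sign
      - 2 * (if 2 * t = e - f then 1 else 0) - 2 * (if 2 * t = e then 1 else 0)
      - 2 * (if 2 * t = 2 * e - f then 1 else 0) - 2 * (if t = e then 1 else 0) := by
  rw [gU]
  rcases sign_cases3 (2 * t - e) with ⟨h3, e3⟩ | ⟨h3, e3⟩ | ⟨h3, e3⟩ <;>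
  rcases sign_cases3 t with ⟨h1, e1⟩ | ⟨h1, e1⟩ | ⟨h1, e1⟩ <;> (try omega) <;>
  rcases sign_cases3 (t - e) with ⟨h2, e2⟩ | ⟨h2, e2⟩ | ⟨h2, e2⟩ <;> (try omega) <;>
  rcases sign_cases3 (2 * t - (e - f)) with ⟨h4, e4⟩ | ⟨h4, e4⟩ | ⟨h4, e4⟩ <;> (try omega) <;>
  rcases sign_cases3 (2 * t - (2 * e - f)) with ⟨h5, e5⟩ | ⟨h5, e5⟩ | ⟨h5, e5⟩ <;> (try omega) <;>
  simp only [sign_two_mul_sub, e1, e2, e3, e4, e5] <;> split_ifs <;> omega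

lemma gU_pos_eq {e f : ℤ} (hf : 0 < f) (h : f = e) (t : ℤ) :
    gU e f t = 2 * t.sign - 2 * (2 * t - 2 * e).sign - 2 * (if t = 0 then 1 else 0)
      - 4 * (if 2 * t = e then 1 else 0) - 2 * (if t = e then 1 else 0) := by
  rw [gU]
  rcases sign_cases3 (2 * t - e) with ⟨h3, e3⟩ | ⟨h3, e3⟩ | ⟨h3, e3⟩ <;>
  rcases sign_cases3 t with ⟨h1, e1⟩ | ⟨h1, e1⟩ | ⟨h1, e1⟩ <;> (try omega) <;>
  rcases sign_cases3 (t - e) with ⟨h2, e2⟩ | ⟨h2, e2⟩ | ⟨h2, e2⟩ <;> (try omega) <;>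
  rcases sign_cases3 (2 * t - (e - f)) with ⟨h4, e4⟩ | ⟨h4, e4⟩ | ⟨h4, e4⟩ <;> (try omega) <;>
  rcases sign_cases3 (2 * t - (2 * e - f)) with ⟨h5, e5⟩ | ⟨h5, e5⟩ | ⟨h5, e5⟩ <;> (try omega) <;>
  simp only [sign_two_mul_sub, e1, e2, e3, e4, e5] <;> split_ifs <;> omega

set_option maxHeartbeats 1000000 in
lemma gU_pos_gt {e f : ℤ} (he : 0 < e) (h : e < f) (t : ℤ) :
    gU e f t = -4 * (2 * t - (e - f)).sign + 6 * t.sign + 2 * (2 * t - (2 * e - f)).sign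
      - 2 * (2 * t - e).sign - 2 * (2 * t - 2 * e).sign + 4 * (if 2 * t = e - f then 1 else 0)
      + 6 * (f - 2 * e).sign * (if 2 * t = 2 * e - f then 1 else 0)
      - 6 * (if 2 * t = e then 1 else 0) - 2 * (if t = e then 1 else 0) := by
  rw [gU]
  rcases sign_cases3 (f - 2 * e) with ⟨h0, e6⟩ | ⟨h0, e6⟩ | ⟨h0, e6⟩ <;> rw [e6] <;>
  rcases sign_cases3 (2 * t - e) with ⟨h3, e3⟩ | ⟨h3, e3⟩ | ⟨h3, e3⟩ <;>
  rcases sign_cases3 t with ⟨h1, e1⟩ | ⟨h1, e1⟩ | ⟨h1, e1⟩ <;> (try omega) <;>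
  rcases sign_cases3 (t - e) with ⟨h2, e2⟩ | ⟨h2, e2⟩ | ⟨h2, e2⟩ <;> (try omega) <;>
  rcases sign_cases3 (2 * t - (e - f)) with ⟨h4, e4⟩ | ⟨h4, e4⟩ | ⟨h4, e4⟩ <;> (try omega) <;>
  rcases sign_cases3 (2 * t - (2 * e - f)) with ⟨h5, e5⟩ | ⟨h5, e5⟩ | ⟨h5, e5⟩ <;> (try omega) <;>
  simp only [sign_two_mul_sub, e1, e2, e3, e4, e5] <;> split_ifs <;> omega

lemma gU_neg_lt {e f : ℤ} (hf : 0 < f) (h : f < e) (t : ℤ) :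
    gU e (-f) t = 2 * (2 * t - e).sign - 2 * (2 * t - (e - -f)).sign
      + 2 * (2 * t - 2 * e).sign - 2 * (2 * t - (2 * e - -f)).sign
      - 2 * (if 2 * t = e then 1 else 0) - 2 * (if 2 * t = e - -f then 1 else 0)
      - 2 * (if t = e then 1 else 0) - 2 * (if 2 * t = 2 * e - -f then 1 else 0) := by
  rw [gU]
  rcases sign_cases3 (2 * t - e) with ⟨h3, e3⟩ | ⟨h3, e3⟩ | ⟨h3, e3⟩ <;>
  rcases sign_cases3 t with ⟨h1, e1⟩ | ⟨h1, e1⟩ | ⟨h1, e1⟩ <;> (try omega) <;>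
  rcases sign_cases3 (t - e) with ⟨h2, e2⟩ | ⟨h2, e2⟩ | ⟨h2, e2⟩ <;> (try omega) <;>
  rcases sign_cases3 (2 * t - (e - -f)) with ⟨h4, e4⟩ | ⟨h4, e4⟩ | ⟨h4, e4⟩ <;> (try omega) <;>
  rcases sign_cases3 (2 * t - (2 * e - -f)) with ⟨h5, e5⟩ | ⟨h5, e5⟩ | ⟨h5, e5⟩ <;> (try omega) <;>
  simp only [sign_two_mul_sub, e1, e2, e3, e4, e5] <;> split_ifs <;> omega

lemma gU_neg_eq {e f : ℤ} (hf : 0 < f) (h : f = e) (t : ℤ) :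
    gU e (-f) t = 2 * (2 * t - e).sign - 2 * (2 * t - (2 * e - -f)).sign
      - 2 * (if 2 * t = e then 1 else 0) - 4 * (if t = e then 1 else 0)
      - 2 * (if 2 * t = 2 * e - -f then 1 else 0) := by
  rw [gU]
  rcases sign_cases3 (2 * t - e) with ⟨h3, e3⟩ | ⟨h3, e3⟩ | ⟨h3, e3⟩ <;>
  rcases sign_cases3 t with ⟨h1, e1⟩ | ⟨h1, e1⟩ | ⟨h1, e1⟩ <;> (try omega) <;>
  rcases sign_cases3 (t - e) with ⟨h2, e2⟩ | ⟨h2, e2⟩ | ⟨h2, e2⟩ <;> (try omega) <;>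
  rcases sign_cases3 (2 * t - (e - -f)) with ⟨h4, e4⟩ | ⟨h4, e4⟩ | ⟨h4, e4⟩ <;> (try omega) <;>
  rcases sign_cases3 (2 * t - (2 * e - -f)) with ⟨h5, e5⟩ | ⟨h5, e5⟩ | ⟨h5, e5⟩ <;> (try omega) <;>
  simp only [e1, e2, e3, e4, e5] <;> split_ifs <;> omega

lemma gU_neg_gt {e f : ℤ} (he : 0 < e) (h : e < f) (t : ℤ) :
    gU e (-f) t = 2 * (2 * t - e).sign - 4 * (2 * t - 2 * e).sign
      + 4 * (2 * t - (e - -f)).sign - 2 * (2 * t - (2 * e - -f)).sign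
      - 2 * (if 2 * t = e then 1 else 0) - 2 * (if 2 * t = 2 * e - -f then 1 else 0) := by
  rw [gU]
  rcases sign_cases3 (2 * t - e) with ⟨h3, e3⟩ | ⟨h3, e3⟩ | ⟨h3, e3⟩ <;>
  rcases sign_cases3 t with ⟨h1, e1⟩ | ⟨h1, e1⟩ | ⟨h1, e1⟩ <;> (try omega) <;>
  rcases sign_cases3 (t - e) with ⟨h2, e2⟩ | ⟨h2, e2⟩ | ⟨h2, e2⟩ <;> (try omega) <;>
  rcases sign_cases3 (2 * t - (e - -f)) with ⟨h4, e4⟩ | ⟨h4, e4⟩ | ⟨h4, e4⟩ <;> (try omega) <;>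
  rcases sign_cases3 (2 * t - (2 * e - -f)) with ⟨h5, e5⟩ | ⟨h5, e5⟩ | ⟨h5, e5⟩ <;> (try omega) <;>
  simp only [sign_two_mul_sub, e1, e2, e3, e4, e5] <;> split_ifs <;> omega

lemma sum_sign (K : ℕ) : ∑ t ∈ Finset.Icc (-(K : ℤ)) K, t.sign = 0 := by
  have := sum_sign_eq K 0 (by simp; omega)
  simpa [Int.sign_mul, show (2 : ℤ).sign = 1 from rfl] using this

/-- The sum of `psi` over a line of the locus `s = p`, closed form. -/
lemma sum_gU {e f : ℤ} (he : 0 < e) (hf : 0 < f) (K : ℕ) (hK : 2 * e + f ≤ K) :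
    ∑ t ∈ Finset.Icc (-(K : ℤ)) K, gU e f t + ∑ t ∈ Finset.Icc (-(K : ℤ)) K, gU e (-f) t =
      if f < e then 8 * f - 4 * (if 2 ∣ e - f then 1 else 0) - 4 * (if 2 ∣ e then 1 else 0)
        - 4 * (if 2 ∣ f then 1 else 0) - 4
      else if f = e then 8 * e - 8 - 8 * (if 2 ∣ e then 1 else 0)
      else 12 * e - 4 * f + 4 * (if 2 ∣ e - f then 1 else 0) - 8 * (if 2 ∣ e then 1 else 0) - 2
        - 2 * (if 2 ∣ f then 1 else 0)
        + 6 * ((f - 2 * e).sign * (if 2 ∣ f then 1 else 0)) := by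
  have S (k : ℤ) (hk : -(2 * K + 1) ≤ k ∧ k ≤ 2 * K + 1) := sum_sign_eq K k (abs_le.2 hk)
  have D (k : ℤ) (hk : -(2 * K) ≤ k ∧ k ≤ 2 * K) := sum_ite_two_mul_eq K k (abs_le.2 hk)
  have D1 (k : ℤ) (hk : -K ≤ k ∧ k ≤ K) := sum_ite_eq_one K k (abs_le.2 hk)
  have d1 : (2 ∣ e - -f) ↔ (2 ∣ e - f) := by omega
  have d2 : (2 ∣ 2 * e - f) ↔ (2 ∣ f) := by omega
  have d3 : (2 ∣ 2 * e - -f) ↔ (2 ∣ f) := by omega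
  rcases lt_trichotomy f e with h | h | h
  · rw [if_pos h]
    simp only [gU_pos_lt hf h, gU_neg_lt hf h, Finset.sum_add_distrib, Finset.sum_sub_distrib,
      ← Finset.mul_sum]
    rw [S _ (by omega), S _ (by omega), S _ (by omega), S _ (by omega), S _ (by omega),
      S _ (by omega), D _ (by omega), D _ (by omega), D _ (by omega), D _ (by omega),
      D _ (by omega), D1 _ (by omega)]
    simp only [d1, d2, d3]
    ring
  · rw [if_neg h.not_lt, if_pos h]
    simp only [gU_pos_eq hf h, gU_neg_eq hf h, Finset.sum_sub_distrib, ← Finset.mul_sum]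
    rw [S _ (by omega), S _ (by omega), S _ (by omega), D _ (by omega), D _ (by omega),
      D1 _ (by omega), D1 _ (by omega), sum_sign]
    subst h
    simp only [show (2 ∣ 2 * f - -f) ↔ 2 ∣ f by omega]
    ring
  · rw [if_neg h.not_gt, if_neg h.ne']
    simp only [gU_pos_gt he h, gU_neg_gt he h, Finset.sum_add_distrib, Finset.sum_sub_distrib,
      ← Finset.mul_sum]
    rw [S _ (by omega), S _ (by omega), S _ (by omega), S _ (by omega), S _ (by omega),
      S _ (by omega), D _ (by omega), D _ (by omega), D _ (by omega),
      D _ (by omega), D1 _ (by omega), sum_sign]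
    simp only [d2, d3]
    ring

lemma gW_pos_lt {s q : ℤ} (hq : 0 < q) (h : q < s) (t : ℤ) :
    gW s q t = 2 * (2 * t - 2 * -s).sign - 4 * (2 * t - 2 * -q).sign
      + 4 * (2 * t - 2 * q).sign - 2 * (2 * t - 2 * s).sign - 2 * (if t = -s then 1 else 0)
      - 2 * (if t = s then 1 else 0) := by
  rw [gW]
  have e0 : s.sign = 1 := Int.sign_eq_one_of_pos (by omega)
  rcases sign_cases3 t with ⟨h1, e1⟩ | ⟨h1, e1⟩ | ⟨h1, e1⟩ <;>
  rcases sign_cases3 (t - s) with ⟨h2, e2⟩ | ⟨h2, e2⟩ | ⟨h2, e2⟩ <;> (try omega) <;>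
  rcases sign_cases3 (t + s) with ⟨h3, e3⟩ | ⟨h3, e3⟩ | ⟨h3, e3⟩ <;> (try omega) <;>
  rcases sign_cases3 (t - q) with ⟨h4, e4⟩ | ⟨h4, e4⟩ | ⟨h4, e4⟩ <;> (try omega) <;>
  rcases sign_cases3 (t + q) with ⟨h5, e5⟩ | ⟨h5, e5⟩ | ⟨h5, e5⟩ <;> (try omega) <;>
  simp only [sign_two_mul_sub, sub_neg_eq_add, e0, e1, e2, e3, e4, e5] <;> split_ifs <;> omega

lemma gW_zero {s q : ℤ} (hq : q = 0) (h : q < s) (t : ℤ) :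
    gW s q t = 2 * (2 * t - 2 * -s).sign - 2 * (2 * t - 2 * s).sign
      - 2 * (if t = -s then 1 else 0) - 2 * (if t = s then 1 else 0)
      - 4 * (if t = 0 then 1 else 0) := by
  rw [gW]
  have e0 : s.sign = 1 := Int.sign_eq_one_of_pos (by omega)
  rcases sign_cases3 t with ⟨h1, e1⟩ | ⟨h1, e1⟩ | ⟨h1, e1⟩ <;>
  rcases sign_cases3 (t - s) with ⟨h2, e2⟩ | ⟨h2, e2⟩ | ⟨h2, e2⟩ <;> (try omega) <;>
  rcases sign_cases3 (t + s) with ⟨h3, e3⟩ | ⟨h3, e3⟩ | ⟨h3, e3⟩ <;> (try omega) <;>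
  rcases sign_cases3 (t - q) with ⟨h4, e4⟩ | ⟨h4, e4⟩ | ⟨h4, e4⟩ <;> (try omega) <;>
  rcases sign_cases3 (t + q) with ⟨h5, e5⟩ | ⟨h5, e5⟩ | ⟨h5, e5⟩ <;> (try omega) <;>
  simp only [sign_two_mul_sub, sub_neg_eq_add, e0, e1, e2, e3, e4, e5] <;> split_ifs <;> omega

lemma gW_neg {s q : ℤ} (hq : q < 0) (h : -q < s) (t : ℤ) :
    gW s q t = 2 * (2 * t - 2 * -s).sign + 2 * (2 * t - 2 * -q).sign - 2 * (2 * t - 2 * q).sign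
      - 2 * (2 * t - 2 * s).sign - 2 * (if t = -s then 1 else 0) - 2 * (if t = s then 1 else 0)
      - 2 * (if t = -q then 1 else 0) - 2 * (if t = q then 1 else 0) := by
  rw [gW]
  have e0 : s.sign = 1 := Int.sign_eq_one_of_pos (by omega)
  rcases sign_cases3 t with ⟨h1, e1⟩ | ⟨h1, e1⟩ | ⟨h1, e1⟩ <;>
  rcases sign_cases3 (t - s) with ⟨h2, e2⟩ | ⟨h2, e2⟩ | ⟨h2, e2⟩ <;> (try omega) <;>
  rcases sign_cases3 (t + s) with ⟨h3, e3⟩ | ⟨h3, e3⟩ | ⟨h3, e3⟩ <;> (try omega) <;>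
  rcases sign_cases3 (t - q) with ⟨h4, e4⟩ | ⟨h4, e4⟩ | ⟨h4, e4⟩ <;> (try omega) <;>
  rcases sign_cases3 (t + q) with ⟨h5, e5⟩ | ⟨h5, e5⟩ | ⟨h5, e5⟩ <;> (try omega) <;>
  simp only [sign_two_mul_sub, sub_neg_eq_add, e0, e1, e2, e3, e4, e5] <;> split_ifs <;> omega

lemma gW_large {s q : ℤ} (hs : 0 < s) (h : s < q) (t : ℤ) :
    gW s q t = -4 * (2 * t - 2 * -q).sign + 2 * (2 * t - 2 * -s).sign - 2 * (2 * t - 2 * s).sign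
      + 4 * (2 * t - 2 * q).sign + 6 * (if t = -s then 1 else 0) + 6 * (if t = s then 1 else 0)
      + 4 * (if t = -q then 1 else 0) + 4 * (if t = q then 1 else 0) := by
  rw [gW]
  have e0 : s.sign = 1 := Int.sign_eq_one_of_pos hs
  rcases sign_cases3 t with ⟨h1, e1⟩ | ⟨h1, e1⟩ | ⟨h1, e1⟩ <;>
  rcases sign_cases3 (t - s) with ⟨h2, e2⟩ | ⟨h2, e2⟩ | ⟨h2, e2⟩ <;> (try omega) <;>
  rcases sign_cases3 (t + s) with ⟨h3, e3⟩ | ⟨h3, e3⟩ | ⟨h3, e3⟩ <;> (try omega) <;>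
  rcases sign_cases3 (t - q) with ⟨h4, e4⟩ | ⟨h4, e4⟩ | ⟨h4, e4⟩ <;> (try omega) <;>
  rcases sign_cases3 (t + q) with ⟨h5, e5⟩ | ⟨h5, e5⟩ | ⟨h5, e5⟩ <;> (try omega) <;>
  simp only [sign_two_mul_sub, sub_neg_eq_add, e0, e1, e2, e3, e4, e5] <;> split_ifs <;> omega

lemma gW_large_zero {s q : ℤ} (hs : s = 0) (h : s < q) (t : ℤ) :
    gW s q t = -(2 * t - 2 * -q).sign + (2 * t - 2 * q).sign + 2 * (if t = 0 then 1 else 0)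
      + (if t = -q then 1 else 0) + (if t = q then 1 else 0) := by
  rw [gW]
  have e0 : s.sign = 0 := by simp [hs]
  rcases sign_cases3 t with ⟨h1, e1⟩ | ⟨h1, e1⟩ | ⟨h1, e1⟩ <;>
  rcases sign_cases3 (t - s) with ⟨h2, e2⟩ | ⟨h2, e2⟩ | ⟨h2, e2⟩ <;> (try omega) <;>
  rcases sign_cases3 (t + s) with ⟨h3, e3⟩ | ⟨h3, e3⟩ | ⟨h3, e3⟩ <;> (try omega) <;>
  rcases sign_cases3 (t - q) with ⟨h4, e4⟩ | ⟨h4, e4⟩ | ⟨h4, e4⟩ <;> (try omega) <;>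
  rcases sign_cases3 (t + q) with ⟨h5, e5⟩ | ⟨h5, e5⟩ | ⟨h5, e5⟩ <;> (try omega) <;>
  simp only [sign_two_mul_sub, sub_neg_eq_add, e0, e1, e2, e3, e4, e5] <;> split_ifs <;> omega

lemma gW_large_neg {s q : ℤ} (hs : s < 0) (h : -s < q) (t : ℤ) :
    gW s q t = 2 * (2 * t - 2 * -q).sign + 2 * (2 * t - 2 * -s).sign - 2 * (2 * t - 2 * s).sign
      - 2 * (2 * t - 2 * q).sign - 2 * (if t = -s then 1 else 0) - 2 * (if t = s then 1 else 0)
      - 2 * (if t = -q then 1 else 0) - 2 * (if t = q then 1 else 0) := by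
  rw [gW]
  have e0 : s.sign = -1 := Int.sign_eq_neg_one_of_neg hs
  rcases sign_cases3 t with ⟨h1, e1⟩ | ⟨h1, e1⟩ | ⟨h1, e1⟩ <;>
  rcases sign_cases3 (t - s) with ⟨h2, e2⟩ | ⟨h2, e2⟩ | ⟨h2, e2⟩ <;> (try omega) <;>
  rcases sign_cases3 (t + s) with ⟨h3, e3⟩ | ⟨h3, e3⟩ | ⟨h3, e3⟩ <;> (try omega) <;>
  rcases sign_cases3 (t - q) with ⟨h4, e4⟩ | ⟨h4, e4⟩ | ⟨h4, e4⟩ <;> (try omega) <;>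
  rcases sign_cases3 (t + q) with ⟨h5, e5⟩ | ⟨h5, e5⟩ | ⟨h5, e5⟩ <;> (try omega) <;>
  simp only [sign_two_mul_sub, sub_neg_eq_add, e0, e1, e2, e3, e4, e5] <;> split_ifs <;> omega

/-- The sum of `psi` over a line of the locus `p = -q`, closed form. -/
lemma sum_gW {a b : ℤ} (hab : 0 < a + b) (hab' : 0 < a - b) (K : ℕ) (hK : 2 * a ≤ K) :
    ∑ t ∈ Finset.Icc (-(K : ℤ)) K, gW a b t + ∑ t ∈ Finset.Icc (-(K : ℤ)) K, gW b a t =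
      if 0 < b then -8 * (a + b) + 16 else if b = 0 then 4 * a - 4 else 16 * (a + b) - 16 := by
  have S (k : ℤ) (hk : -(K) ≤ k ∧ k ≤ K) := sum_sign_eq K (2 * k) (abs_le.2 (by omega))
  have D (k : ℤ) (hk : -K ≤ k ∧ k ≤ K) := sum_ite_eq_one K k (abs_le.2 hk)
  rcases lt_trichotomy 0 b with h | h | h
  · rw [if_pos h]
    simp only [gW_pos_lt h (show b < a by omega), gW_large h (show b < a by omega),
      Finset.sum_add_distrib, Finset.sum_sub_distrib, ← Finset.mul_sum]
    rw [S _ (by omega), S _ (by omega), S _ (by omega), S _ (by omega),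
      D _ (by omega), D _ (by omega), D _ (by omega), D _ (by omega)]
    ring
  · rw [if_neg h.not_lt, if_pos h.symm]
    simp only [gW_zero h.symm (show b < a by omega), gW_large_zero h.symm (show b < a by omega),
      Finset.sum_add_distrib, Finset.sum_sub_distrib, ← Finset.mul_sum, Finset.sum_neg_distrib]
    rw [S _ (by omega), S _ (by omega),
      D _ (by omega), D _ (by omega), D _ (by omega)]
    ring
  · rw [if_neg h.not_gt, if_neg h.ne]
    simp only [gW_neg h (show -b < a by omega), gW_large_neg h (show -b < a by omega),
      Finset.sum_add_distrib, Finset.sum_sub_distrib, ← Finset.mul_sum]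
    rw [S _ (by omega), S _ (by omega), S _ (by omega), S _ (by omega),
      D _ (by omega), D _ (by omega), D _ (by omega), D _ (by omega)]
    ring

/-- Factorizations of `m` into two positive integers. -/
noncomputable def pairs (m : ℤ) : Finset (ℤ × ℤ) :=
  {x ∈ Finset.Icc 1 m ×ˢ Finset.Icc 1 m | x.1 * x.2 = m}

lemma mem_pairs {m e f : ℤ} : (e, f) ∈ pairs m ↔ 0 < e ∧ 0 < f ∧ e * f = m := by
  simp only [pairs, Finset.mem_filter, Finset.mem_product, Finset.mem_Icc]
  constructor
  · rintro ⟨⟨⟨h1, -⟩, h2, -⟩, h⟩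
    exact ⟨h1, h2, h⟩
  · rintro ⟨h1, h2, rfl⟩
    exact ⟨⟨⟨h1, by nlinarith⟩, h2, by nlinarith⟩, rfl⟩

/-- Factorizations of `± m` into two integers. -/
noncomputable def signedPairs (m : ℤ) : Finset (ℤ × ℤ) :=
  {x ∈ Finset.Icc (-m) m ×ˢ Finset.Icc (-m) m | x.1 * x.2 = m ∨ x.1 * x.2 = -m}

lemma abs_mul_abs_of_mul {m e f : ℤ} (hm : 0 < m) (h : e * f = m ∨ e * f = -m) :
    0 < |e| ∧ 0 < |f| ∧ |e| * |f| = m := by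
  have h1 : |e| * |f| = m := by
    rw [← abs_mul]
    rcases h with h | h <;> rw [h]
    · exact abs_of_pos hm
    · rw [abs_neg, abs_of_pos hm]
  refine ⟨?_, ?_, h1⟩ <;> rw [abs_pos] <;> rintro rfl <;> simp at h1 <;> omega

lemma mem_signedPairs {m e f : ℤ} (hm : 0 < m) :
    (e, f) ∈ signedPairs m ↔ e * f = m ∨ e * f = -m := by
  simp only [signedPairs, Finset.mem_filter, Finset.mem_product, Finset.mem_Icc,
    and_iff_right_iff_imp]
  intro h
  obtain ⟨h1, h2, h3⟩ := abs_mul_abs_of_mul hm h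
  rw [← abs_le, ← abs_le]
  constructor <;> nlinarith

lemma sum_signedPairs {m : ℤ} (hm : 0 < m) (h : ℤ × ℤ → ℤ) :
    ∑ x ∈ signedPairs m, h x = ∑ x ∈ pairs m,
      (h (x.1, x.2) + h (x.1, -x.2) + h (-x.1, x.2) + h (-x.1, -x.2)) := by
  have : ∑ x ∈ signedPairs m, h x =
      ∑ y ∈ pairs m ×ˢ (({1, -1} : Finset ℤ) ×ˢ ({1, -1} : Finset ℤ)),
        h (y.2.1 * y.1.1, y.2.2 * y.1.2) := by
    refine Finset.sum_nbij' (fun x => ((|x.1|, |x.2|), (x.1.sign, x.2.sign)))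
      (fun y => (y.2.1 * y.1.1, y.2.2 * y.1.2)) ?_ ?_ ?_ ?_ ?_
    · rintro ⟨e, f⟩ hx
      rw [mem_signedPairs hm] at hx
      obtain ⟨h1, h2, h3⟩ := abs_mul_abs_of_mul hm hx
      simp only [Finset.mem_product, mem_pairs, Finset.mem_insert, Finset.mem_singleton]
      rcases sign_cases (abs_pos.1 h1) with ⟨-, e1⟩ | ⟨-, e1⟩ <;>
        rcases sign_cases (abs_pos.1 h2) with ⟨-, e2⟩ | ⟨-, e2⟩ <;> simp [*]
    · rintro ⟨⟨e, f⟩, σ, ε⟩ hy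
      simp only [Finset.mem_product, mem_pairs, Finset.mem_insert, Finset.mem_singleton] at hy
      obtain ⟨⟨h1, h2, rfl⟩, rfl | rfl, rfl | rfl⟩ := hy <;> simp [mem_signedPairs, mul_pos h1 h2]
    · rintro ⟨e, f⟩ -
      simp [Int.sign_mul_abs]
    · rintro ⟨⟨e, f⟩, σ, ε⟩ hy
      simp only [Finset.mem_product, mem_pairs, Finset.mem_insert, Finset.mem_singleton] at hy
      obtain ⟨⟨h1, h2, rfl⟩, rfl | rfl, rfl | rfl⟩ := hy <;>
        simp [abs_of_pos, h1, h2, Int.sign_eq_one_of_pos]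
    · rintro ⟨e, f⟩ -
      simp [Int.sign_mul_abs]
  rw [this, Finset.sum_product]
  refine Finset.sum_congr rfl ?_
  rintro ⟨e, f⟩ -
  rw [Finset.sum_product]
  simp [← add_assoc]

lemma sum_Icc_neg (K : ℤ) (g : ℤ → ℤ) :
    ∑ t ∈ Finset.Icc (-K) K, g (-t) = ∑ t ∈ Finset.Icc (-K) K, g t := by
  refine Finset.sum_nbij' (fun t => -t) (fun t => -t) ?_ ?_ ?_ ?_ ?_ <;>
    simp only [Finset.mem_Icc, neg_neg, implies_true] <;> omega

lemma psi_eq_gU {e f t : ℤ} (h : Reg (e - t, e - t, f - e + t, t)) :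
    psi (e - t) (e - t) (f - e + t) t = gU e f t := by
  simp only [Reg] at h
  rw [gU, if_neg (by omega)]
  have h0 : e.sign * e.sign = 1 := by
    rcases sign_cases (show e ≠ 0 by omega) with ⟨-, e1⟩ | ⟨-, e1⟩ <;> rw [e1] <;> rfl
  have e1 : e - t + t = e := by ring
  have e2 : e - t - t = -(2 * t - e) := by ring
  have e3 : f - e + t + t = 2 * t - (e - f) := by ring
  have e4 : e - t - (f - e + t) = -(2 * t - (2 * e - f)) := by ring
  have e5 : e - t + (e - t) = -(2 * (t - e)) := by ring
  have e6 : e - t = -(t - e) := by ring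
  rw [psi, e1, e2, e3, e4, e5, e6]
  simp only [Int.sign_neg, Int.sign_mul, h0, show (2 : ℤ).sign = 1 from rfl]
  ring

lemma reg_of_gU_ne_zero {e f t : ℤ} (he : e ≠ 0) (h : gU e f t ≠ 0) :
    Reg (e - t, e - t, f - e + t, t) := by
  rw [gU] at h
  split_ifs at h with h'
  · exact absurd rfl h
  · simp only [Reg]; omega

lemma gU_neg (e f t : ℤ) : gU (-e) (-f) (-t) = gU e f t := by
  have h1 : 2 * -t - -e = -(2 * t - e) := by ring
  have h2 : 2 * -t - (-e - -f) = -(2 * t - (e - f)) := by ring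
  have h3 : 2 * -t - (2 * -e - -f) = -(2 * t - (2 * e - f)) := by ring
  have h4 : -t - -e = -(t - e) := by ring
  simp only [gU, h1, h2, h3, h4, Int.sign_neg]
  congr 1
  · apply propext; omega
  · ring

lemma sum_psi_locus_s_eq_p {m : ℤ} (hm : 0 < m) :
    ∑ v ∈ boxSol m with Reg v ∧ v.1 = v.2.1, psi' v =
      2 * ∑ x ∈ pairs m, (∑ t ∈ Finset.Icc (-(3 * m)) (3 * m), gU x.1 x.2 t +
        ∑ t ∈ Finset.Icc (-(3 * m)) (3 * m), gU x.1 (-x.2) t) := by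
  have h1 : ∑ v ∈ boxSol m with Reg v ∧ v.1 = v.2.1, psi' v =
      ∑ y ∈ signedPairs m ×ˢ Finset.Icc (-(3 * m)) (3 * m), gU y.1.1 y.1.2 y.2 := by
    refine Finset.sum_of_injOn (fun v => ((v.1 + v.2.2.2, v.2.1 + v.2.2.1), v.2.2.2)) ?_ ?_ ?_ ?_
    · rintro ⟨s, p, q, t⟩ hv ⟨s', p', q', t'⟩ hv' h
      simp only [Finset.coe_filter, Set.mem_ofPred_eq, Prod.mk.injEq] at hv hv' h ⊢
      omega
    · rintro ⟨s, p, q, t⟩ hv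
      rw [Finset.mem_coe, Finset.mem_filter, mem_boxSol] at hv
      obtain ⟨⟨h, hQ⟩, -, hp⟩ := hv
      obtain rfl : s = p := hp
      simp only [Finset.mem_coe, Finset.mem_product, mem_signedPairs hm, Finset.mem_Icc]
      refine ⟨?_, h.2.2.2⟩
      rcases hQ with h | h <;> [left; right] <;> linear_combination h
    · rintro ⟨⟨e, f⟩, t⟩ hy hn
      simp only [Finset.mem_product, mem_signedPairs hm, Finset.mem_Icc] at hy
      by_contra h0
      have he : e ≠ 0 := abs_pos.1 (abs_mul_abs_of_mul hm hy.1).1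
      have hr := reg_of_gU_ne_zero he h0
      apply hn
      refine ⟨(e - t, e - t, f - e + t, t), ?_, by simp⟩
      rw [Finset.mem_coe, Finset.mem_filter]
      refine ⟨psi_bound hm.le hr (by rwa [psi_eq_gU hr]) ?_, hr, rfl⟩
      rcases hy.1 with h | h <;> [left; right] <;> linear_combination h
    · rintro ⟨s, p, q, t⟩ hv
      rw [Finset.mem_filter] at hv
      obtain ⟨-, hr, h⟩ := hv
      obtain rfl : s = p := h
      have e1 : s = s + t - t := by ring
      have e2 : q = s + q - (s + t) + t := by ring
      rw [e1, e2] at hr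
      change psi s s q t = gU (s + t) (s + q) t
      rw [← psi_eq_gU (by simpa using hr), ← e1, ← e2]
  rw [h1, Finset.sum_product, sum_signedPairs hm (fun x => ∑ t ∈ _, gU x.1 x.2 t), Finset.mul_sum]
  refine Finset.sum_congr rfl fun x _ => ?_
  rw [← sum_Icc_neg _ (gU (-x.1) x.2), ← sum_Icc_neg _ (gU (-x.1) (-x.2))]
  have : ∀ t, gU (-x.1) x.2 (-t) = gU x.1 (-x.2) t := fun t => by
    rw [← gU_neg x.1, neg_neg]
  simp only [this, gU_neg]
  ring

lemma sum_psi_locus_s_eq_neg_q (m : ℤ) :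
    ∑ v ∈ boxSol m with Reg v ∧ v.1 = -v.2.2.1, psi' v =
      ∑ v ∈ boxSol m with Reg v ∧ v.1 = v.2.1, psi' v := by
  refine Finset.sum_nbij' (fun v => (-v.1, v.2.2.1, v.2.1, v.2.2.2))
    (fun v => (-v.1, v.2.2.1, v.2.1, v.2.2.2)) ?_ ?_ ?_ ?_ ?_
  · rintro ⟨s, p, q, t⟩ hv
    rw [Finset.mem_filter, mem_boxSol] at hv ⊢
    simp only [Reg] at hv ⊢
    refine ⟨⟨by omega, ?_⟩, by omega⟩
    rcases hv.1.2 with h | h <;> [left; right] <;> linear_combination h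
  · rintro ⟨s, p, q, t⟩ hv
    rw [Finset.mem_filter, mem_boxSol] at hv ⊢
    simp only [Reg] at hv ⊢
    refine ⟨⟨by omega, ?_⟩, by omega⟩
    rcases hv.1.2 with h | h <;> [left; right] <;> linear_combination h
  · simp
  · simp
  · rintro ⟨s, p, q, t⟩ -
    have h1 : -s + t = -(s - t) := by ring
    have h2 : -s - t = -(s + t) := by ring
    have h3 : -s - p = -(s + p) := by ring
    have h4 : -s + q = -(s - q) := by ring
    simp only [psi', psi, h1, h2, h3, h4, Int.sign_neg]
    ring

lemma psi_eq_gW {s q t : ℤ} (h : Reg (s, -q, q, t)) : psi s (-q) q t = gW s q t := by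
  simp only [Reg] at h
  rw [gW, if_neg (by omega)]
  have h0 : (s - q).sign * (s - q).sign = 1 := by
    rcases sign_cases (show s - q ≠ 0 by omega) with ⟨-, e1⟩ | ⟨-, e1⟩ <;> rw [e1] <;> rfl
  have e1 : s + t = t + s := by ring
  have e2 : s - t = -(t - s) := by ring
  have e3 : q + t = t + q := by ring
  have e4 : -q + t = t - q := by ring
  have e5 : s + -q = s - q := by ring
  rw [psi, e1, e2, e3, e4, e5, h0]
  simp only [Int.sign_neg]
  ring

lemma reg_of_gW_ne_zero {s q t : ℤ} (he : s - q ≠ 0) (h : gW s q t ≠ 0) :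
    Reg (s, -q, q, t) := by
  rw [gW] at h
  split_ifs at h with h'
  · exact absurd rfl h
  · simp only [Reg]; omega

lemma gW_neg_neg (s q t : ℤ) : gW (-s) (-q) (-t) = gW s q t := by
  have h1 : -t + -s = -(t + s) := by ring
  have h2 : -t - -s = -(t - s) := by ring
  have h3 : -t + -q = -(t + q) := by ring
  have h4 : -t - -q = -(t - q) := by ring
  simp only [gW, h1, h2, h3, h4, Int.sign_neg]
  congr 1
  · apply propext; omega
  · ring

lemma sum_psi_locus_p_eq_neg_q {m : ℤ} (hm : 0 < m) :
    ∑ v ∈ boxSol m with Reg v ∧ v.2.1 = -v.2.2.1, psi' v =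
      2 * ∑ x ∈ pairs m, if 2 ∣ x.1 - x.2 then
        (∑ t ∈ Finset.Icc (-(3 * m)) (3 * m), gW ((x.1 + x.2) / 2) ((x.1 - x.2) / 2) t +
        ∑ t ∈ Finset.Icc (-(3 * m)) (3 * m), gW ((x.1 - x.2) / 2) ((x.1 + x.2) / 2) t) else 0 := by
  have h1 : ∑ v ∈ boxSol m with Reg v ∧ v.2.1 = -v.2.2.1, psi' v =
      ∑ y ∈ signedPairs m ×ˢ Finset.Icc (-(3 * m)) (3 * m), if 2 ∣ y.1.1 - y.1.2 then
        gW ((y.1.1 + y.1.2) / 2) ((y.1.1 - y.1.2) / 2) y.2 else 0 := by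
    refine Finset.sum_of_injOn (fun v => ((v.1 + v.2.2.1, v.1 - v.2.2.1), v.2.2.2)) ?_ ?_ ?_ ?_
    · rintro ⟨s, p, q, t⟩ hv ⟨s', p', q', t'⟩ hv' h
      simp only [Finset.coe_filter, Set.mem_ofPred_eq, Prod.mk.injEq] at hv hv' h ⊢
      omega
    · rintro ⟨s, p, q, t⟩ hv
      rw [Finset.mem_coe, Finset.mem_filter, mem_boxSol] at hv
      obtain ⟨⟨h, hQ⟩, -, hp⟩ := hv
      obtain rfl : p = -q := hp
      simp only [Finset.mem_coe, Finset.mem_product, mem_signedPairs hm, Finset.mem_Icc]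
      refine ⟨?_, h.2.2.2⟩
      rcases hQ with h | h <;> [left; right] <;> linear_combination h
    · rintro ⟨⟨e, f⟩, t⟩ hy hn
      simp only [Finset.mem_product, mem_signedPairs hm, Finset.mem_Icc] at hy
      by_contra h0
      simp only [ite_eq_right_iff, Classical.not_imp] at h0
      obtain ⟨⟨b, hb⟩, h0⟩ := h0
      obtain rfl : e = f + 2 * b := by omega
      have e1 : (f + 2 * b + f) / 2 = f + b := by omega
      have e2 : (f + 2 * b - f) / 2 = b := by omega
      rw [e1, e2] at h0
      have he : f ≠ 0 := abs_pos.1 (abs_mul_abs_of_mul hm hy.1).2.1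
      have hr := reg_of_gW_ne_zero (by omega) h0
      apply hn
      refine ⟨(f + b, -b, b, t), ?_, by simp; ring⟩
      rw [Finset.mem_coe, Finset.mem_filter]
      refine ⟨psi_bound hm.le hr (by rwa [psi_eq_gW hr]) ?_, hr, rfl⟩
      rcases hy.1 with h | h <;> [left; right] <;> linear_combination h
    · rintro ⟨s, p, q, t⟩ hv
      rw [Finset.mem_filter] at hv
      obtain ⟨-, hr, h⟩ := hv
      obtain rfl : p = -q := h
      change psi s (-q) q t = if 2 ∣ (s + q) - (s - q) then
        gW ((s + q + (s - q)) / 2) ((s + q - (s - q)) / 2) t else 0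
      rw [if_pos (by omega), psi_eq_gW hr]
      congr 1 <;> omega
  rw [h1, Finset.sum_product, sum_signedPairs hm (fun x => ∑ t ∈ _, if 2 ∣ x.1 - x.2 then
    gW ((x.1 + x.2) / 2) ((x.1 - x.2) / 2) t else 0), Finset.mul_sum]
  refine Finset.sum_congr rfl ?_
  rintro ⟨e, f⟩ -
  simp only
  by_cases h : 2 ∣ e - f
  · obtain ⟨b, hb⟩ := h
    obtain rfl : e = f + 2 * b := by omega
    simp only [show 2 ∣ f + 2 * b - f by omega, show 2 ∣ f + 2 * b - -f by omega,
      show 2 ∣ -(f + 2 * b) - f by omega, show 2 ∣ -(f + 2 * b) - -f by omega, if_true,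
      show (f + 2 * b + f) / 2 = f + b by omega, show (f + 2 * b - f) / 2 = b by omega,
      show (f + 2 * b + -f) / 2 = b by omega, show (f + 2 * b - -f) / 2 = f + b by omega,
      show (-(f + 2 * b) + f) / 2 = -b by omega, show (-(f + 2 * b) - f) / 2 = -(f + b) by omega,
      show (-(f + 2 * b) + -f) / 2 = -(f + b) by omega, show (-(f + 2 * b) - -f) / 2 = -b by omega]
    rw [← sum_Icc_neg _ (gW (-b) (-(f + b))), ← sum_Icc_neg _ (gW (-(f + b)) (-b))]
    simp only [gW_neg_neg]
    ring
  · simp [h, show ¬ 2 ∣ e + f by omega, show ¬ 2 ∣ -e + f by omega, show ¬ 2 ∣ -e - f by omega]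

/-- Solutions of `s ^ 2 + p q + q t + t p = m` in a box. -/
noncomputable def sol (m : ℤ) : Finset (ℤ × ℤ × ℤ × ℤ) :=
  {v ∈ boxSol m | v.1 ^ 2 + v.2.1 * v.2.2.1 + v.2.2.1 * v.2.2.2 + v.2.2.2 * v.2.1 = m}

lemma mem_sol {m s p q t : ℤ} : (s, p, q, t) ∈ sol m ↔
    ((-(3 * m) ≤ s ∧ s ≤ 3 * m) ∧ (-(3 * m) ≤ p ∧ p ≤ 3 * m) ∧ (-(3 * m) ≤ q ∧ q ≤ 3 * m) ∧
      (-(3 * m) ≤ t ∧ t ≤ 3 * m)) ∧ s ^ 2 + p * q + q * t + t * p = m := by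
  rw [sol, Finset.mem_filter, mem_boxSol]
  simp only
  tauto

lemma triWt_rot (p q t : ℤ) : triWt q t p = triWt p q t := by
  unfold triWt
  rw [show q * t + t * p + p * q = p * q + q * t + t * p by ring]
  congr 1
  · apply propext; tauto
  · congr 1
    apply propext; tauto

lemma triWt_ne_zero {p q t : ℤ} (h : triWt p q t ≠ 0) :
    0 ≤ p ∧ 0 ≤ q ∧ 0 ≤ t ∧ 0 < p + q ∧ 0 < p + t ∧ 0 < q + t := by
  rw [triWt, ite_ne_right_iff] at h
  obtain ⟨⟨hp, hq, ht, h⟩, -⟩ := h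
  refine ⟨hp, hq, ht, ?_, ?_, ?_⟩ <;> by_contra! hc
  · obtain rfl : p = 0 := by omega
    obtain rfl : q = 0 := by omega
    simp at h
  · obtain rfl : p = 0 := by omega
    obtain rfl : t = 0 := by omega
    simp at h
  · obtain rfl : q = 0 := by omega
    obtain rfl : t = 0 := by omega
    simp at h

lemma triWt_of_pos {p q t : ℤ} (hp : 0 < p) (hq : 0 < q) (ht : 0 < t) : triWt p q t = 4 := by
  rw [triWt, if_pos ⟨hp.le, hq.le, ht.le, by positivity⟩, if_neg (by omega)]

lemma triWt_zero {p q : ℤ} (hp : 0 < p) (hq : 0 < q) : triWt p q 0 = 2 := by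
  rw [triWt, if_pos ⟨hp.le, hq.le, le_rfl, by simpa using mul_pos hp hq⟩, if_pos (by simp)]

lemma mem_sol_of_triWt {m s p q t : ℤ} (h : triWt p q t ≠ 0)
    (hQ : s ^ 2 + p * q + q * t + t * p = m) : (s, p, q, t) ∈ sol m := by
  obtain ⟨hp, hq, ht, h1, h2, h3⟩ := triWt_ne_zero h
  rw [mem_sol]
  refine ⟨?_, hQ⟩
  have hpq := mul_nonneg hp hq
  have hqt := mul_nonneg hq ht
  have htp := mul_nonneg ht hp
  have a1 : p ≤ p * q + t * p := by nlinarith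
  have a2 : q ≤ p * q + q * t := by nlinarith
  have a3 : t ≤ t * p + q * t := by nlinarith
  have a4 : s ≤ s ^ 2 := by nlinarith [sq_nonneg (s - 1), sq_nonneg s, Int.le_self_sq s]
  have a5 : -s ≤ s ^ 2 := by simpa using Int.le_self_sq (-s)
  have a6 := sq_nonneg s
  omega

lemma sum_sol_rot (m : ℤ) (h : ℤ × ℤ × ℤ × ℤ → ℤ) :
    ∑ v ∈ sol m, h v = ∑ v ∈ sol m, h (v.1, v.2.2.1, v.2.2.2, v.2.1) := by
  refine Finset.sum_nbij' (fun v => (v.1, v.2.2.2, v.2.1, v.2.2.1))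
    (fun v => (v.1, v.2.2.1, v.2.2.2, v.2.1)) ?_ ?_ ?_ ?_ ?_
  · rintro ⟨s, p, q, t⟩ hv
    rw [mem_sol] at hv ⊢
    exact ⟨by simp only; omega, by linear_combination hv.2⟩
  · rintro ⟨s, p, q, t⟩ hv
    rw [mem_sol] at hv ⊢
    exact ⟨by simp only; omega, by linear_combination hv.2⟩
  · rintro ⟨s, p, q, t⟩ -; rfl
  · rintro ⟨s, p, q, t⟩ -; rfl
  · rintro ⟨s, p, q, t⟩ -; rfl

/-- Inclusion-exclusion over the non-generic solutions. -/
lemma sum_triWt_split (m : ℤ) :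
    ∑ v ∈ sol m, triWt v.2.1 v.2.2.1 v.2.2.2 =
      ∑ v ∈ boxSol m with Full v ∧
        v.1 ^ 2 + v.2.1 * v.2.2.1 + v.2.2.1 * v.2.2.2 + v.2.2.2 * v.2.1 = m,
          triWt v.2.1 v.2.2.1 v.2.2.2
      + 3 * ∑ v ∈ sol m with v.1 = v.2.1 ∨ v.1 = -v.2.1, triWt v.2.1 v.2.2.1 v.2.2.2
      - 3 * ∑ v ∈ sol m with (v.1 = v.2.1 ∨ v.1 = -v.2.1) ∧ v.2.1 = v.2.2.1,
          triWt v.2.1 v.2.2.1 v.2.2.2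
      + ∑ v ∈ sol m with (v.1 = v.2.1 ∨ v.1 = -v.2.1) ∧ v.2.1 = v.2.2.1 ∧ v.2.1 = v.2.2.2,
          triWt v.2.1 v.2.2.1 v.2.2.2 := by
  have r1 := sum_sol_rot m fun v =>
    if v.1 = v.2.1 ∨ v.1 = -v.2.1 then triWt v.2.1 v.2.2.1 v.2.2.2 else 0
  have r2 := sum_sol_rot m fun v =>
    if v.1 = v.2.2.1 ∨ v.1 = -v.2.2.1 then triWt v.2.2.1 v.2.2.2 v.2.1 else 0
  have r3 := sum_sol_rot m fun v =>
    if (v.1 = v.2.1 ∨ v.1 = -v.2.1) ∧ v.2.1 = v.2.2.1 then triWt v.2.1 v.2.2.1 v.2.2.2 else 0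
  have r4 := sum_sol_rot m fun v =>
    if (v.1 = v.2.2.1 ∨ v.1 = -v.2.2.1) ∧ v.2.2.1 = v.2.2.2 then triWt v.2.2.1 v.2.2.2 v.2.1 else 0
  have e1 : ∑ v ∈ boxSol m with Full v ∧
        v.1 ^ 2 + v.2.1 * v.2.2.1 + v.2.2.1 * v.2.2.2 + v.2.2.2 * v.2.1 = m,
          triWt v.2.1 v.2.2.1 v.2.2.2 =
      ∑ v ∈ sol m, if Full v then triWt v.2.1 v.2.2.1 v.2.2.2 else 0 := by
    rw [← Finset.sum_filter, sol, Finset.filter_filter]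
    simp only [and_comm]
  rw [e1]
  simp only [Finset.sum_filter]
  have expand (x y z : ℤ) (hx : x = y) (hxz : y = z) : 3 * x = x + y + z := by rw [hx, hxz]; ring
  rw [expand _ _ _ r1 r2, expand _ _ _ r3 r4]
  simp only [← Finset.sum_add_distrib, ← Finset.sum_sub_distrib]
  refine Finset.sum_congr rfl ?_
  rintro ⟨s, p, q, t⟩ -
  simp only
  rw [triWt_rot p q t, triWt_rot t p q]
  by_cases h0 : triWt p q t = 0
  · simp [h0, ← triWt_rot t p q]
  obtain ⟨hp, hq, ht, h1, h2, h3⟩ := triWt_ne_zero h0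
  rw [← triWt_rot t p q]
  generalize triWt p q t = w
  have hF : Full (s, p, q, t) ↔ ¬ (s = p ∨ s = -p) ∧ ¬ (s = q ∨ s = -q) ∧ ¬ (s = t ∨ s = -t) := by
    simp only [Full, Reg]; omega
  have hpq : ((s = p ∨ s = -p) ∧ p = q) ↔ (s = p ∨ s = -p) ∧ (s = q ∨ s = -q) := by omega
  have hqt : ((s = q ∨ s = -q) ∧ q = t) ↔ (s = q ∨ s = -q) ∧ (s = t ∨ s = -t) := by omega
  have htp : ((s = t ∨ s = -t) ∧ t = p) ↔ (s = t ∨ s = -t) ∧ (s = p ∨ s = -p) := by omega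
  have hpqt : ((s = p ∨ s = -p) ∧ p = q ∧ p = t) ↔
    (s = p ∨ s = -p) ∧ (s = q ∨ s = -q) ∧ (s = t ∨ s = -t) := by omega
  simp only [hF, hpq, hqt, htp, hpqt]
  by_cases hA : s = p ∨ s = -p <;> by_cases hB : s = q ∨ s = -q <;>
    by_cases hC : s = t ∨ s = -t <;> simp only [hA, hB, hC] <;> simp

lemma sum_Icc_triWt {e f K : ℤ} (he : 0 < e) (hf : 0 < f) (hK : min e f ≤ K) :
    ∑ s ∈ Finset.Icc (-K) K, triWt |s| (e - |s|) (f - |s|) =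
      8 * min e f - 6 + 4 * (if e = f then 0 else 1) := by
  have h : ∀ s, triWt |s| (e - |s|) (f - |s|) =
      4 * (if s ∈ Finset.Ioo (-min e f) (min e f) then 1 else 0) - 2 * (if s = 0 then 1 else 0)
        + 2 * (if e = f then 0 else 1) * ((if s = min e f then 1 else 0)
          + (if s = -min e f then 1 else 0)) := by
    intro s
    have hs := abs_nonneg s
    have hi : s ∈ Finset.Ioo (-min e f) (min e f) ↔ |s| < min e f := by
      rw [Finset.mem_Ioo, abs_lt]
    have h0 : s = 0 ↔ |s| = 0 := abs_eq_zero.symm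
    have hm : (if s = min e f then 1 else 0 : ℤ) + (if s = -min e f then 1 else 0) =
        if |s| = min e f then 1 else 0 := by
      have : |s| = min e f ↔ s = min e f ∨ s = -min e f := abs_eq (by omega)
      rw [if_congr this rfl rfl]
      split_ifs <;> omega
    rw [hm]
    simp only [hi, h0]
    generalize |s| = a at *
    rcases lt_trichotomy a (min e f) with h | h | h
    · rcases hs.eq_or_lt with rfl | ha
      · rw [← triWt_rot, sub_zero, sub_zero, triWt_zero he hf]
        simp [h, h.ne]
      · rw [triWt_of_pos ha (by omega) (by omega)]
        simp [h, h.ne, ha.ne']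
    · rcases lt_trichotomy e f with h' | h' | h'
      · rw [min_eq_left h'.le] at *
        subst h
        rw [sub_self, triWt_rot, triWt_zero (by omega) he]
        simp [h'.ne, he.ne']
      · subst h'
        rw [min_self] at *
        subst h
        simp [triWt, he.ne']
      · rw [min_eq_right h'.le] at *
        subst h
        rw [sub_self, triWt_zero hf (by omega)]
        simp [h'.ne', hf.ne']
    · have : triWt a (e - a) (f - a) = 0 := by
        by_contra hc
        have := triWt_ne_zero hc
        omega
      rw [this]
      simp [h.not_gt, h.ne', show a ≠ 0 by omega]
  simp only [h, Finset.sum_add_distrib, Finset.sum_sub_distrib, ← Finset.mul_sum]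
  have hM : 0 < min e f := lt_min he hf
  have c1 : ∑ s ∈ Finset.Icc (-K) K, (if s ∈ Finset.Ioo (-min e f) (min e f) then 1 else 0 : ℤ) =
      2 * min e f - 1 := by
    rw [Finset.sum_ite_mem, Finset.inter_eq_right.2, Finset.sum_const, Int.card_Ioo]
    · simp only [nsmul_eq_mul, mul_one]
      omega
    · intro x hx
      rw [Finset.mem_Ioo] at hx
      rw [Finset.mem_Icc]
      omega
  have c2 (c : ℤ) (hc : -K ≤ c ∧ c ≤ K) :
      ∑ s ∈ Finset.Icc (-K) K, (if s = c then 1 else 0 : ℤ) = 1 := by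
    rw [Finset.sum_ite_eq', if_pos (Finset.mem_Icc.2 hc)]
  rw [c1, c2 _ (by omega), c2 _ (by omega), c2 _ (by omega)]
  ring

lemma sum_triWt_one {m : ℤ} (hm : 0 < m) :
    ∑ v ∈ sol m with v.1 = v.2.1 ∨ v.1 = -v.2.1, triWt v.2.1 v.2.2.1 v.2.2.2 =
      ∑ x ∈ pairs m, (8 * min x.1 x.2 - 6 + 4 * (if x.1 = x.2 then 0 else 1)) := by
  have h1 : ∑ v ∈ sol m with v.1 = v.2.1 ∨ v.1 = -v.2.1, triWt v.2.1 v.2.2.1 v.2.2.2 =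
      ∑ y ∈ pairs m ×ˢ Finset.Icc (-(3 * m)) (3 * m),
        triWt |y.2| (y.1.1 - |y.2|) (y.1.2 - |y.2|) := by
    rw [← Finset.sum_filter_ne_zero, Finset.filter_filter]
    have key : ∀ {s p q t : ℤ}, (s, p, q, t) ∈ {v ∈ sol m | (v.1 = v.2.1 ∨ v.1 = -v.2.1) ∧
        triWt v.2.1 v.2.2.1 v.2.2.2 ≠ 0} → p = |s| := by
      intro s p q t hv
      rw [Finset.mem_filter] at hv
      obtain ⟨-, h, h'⟩ := hv
      have hp := (triWt_ne_zero h').1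
      simp only at h hp
      rcases h with h | h <;> rw [h]
      · exact (abs_of_nonneg hp).symm
      · rw [abs_neg, abs_of_nonneg hp]
    refine Finset.sum_of_injOn (fun v => ((v.2.1 + v.2.2.1, v.2.1 + v.2.2.2), v.1)) ?_ ?_ ?_ ?_
    · rintro ⟨s, p, q, t⟩ hv ⟨s', p', q', t'⟩ hv' h
      have h1 := key hv
      have h2 := key hv'
      simp only [Prod.mk.injEq] at h ⊢
      obtain ⟨⟨h3, h4⟩, rfl⟩ := h
      omega
    · rintro ⟨s, p, q, t⟩ hv
      have h1 := key hv
      rw [Finset.mem_coe, Finset.mem_filter, mem_sol] at hv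
      obtain ⟨⟨h, hQ⟩, -, hp⟩ := hv
      have := triWt_ne_zero hp
      simp only [Finset.mem_coe, Finset.mem_product, mem_pairs, Finset.mem_Icc] at this ⊢
      refine ⟨⟨by omega, by omega, ?_⟩, h.1⟩
      have : p ^ 2 = s ^ 2 := by rw [h1, sq_abs]
      linear_combination hQ + this
    · rintro ⟨⟨e, f⟩, s⟩ hy hn
      simp only [Finset.mem_product, mem_pairs] at hy
      by_contra h0
      apply hn
      refine ⟨(s, |s|, e - |s|, f - |s|), ?_, by simp⟩
      rw [Finset.mem_coe, Finset.mem_filter]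
      refine ⟨mem_sol_of_triWt h0 ?_, ?_, h0⟩
      · have := sq_abs s
        linear_combination hy.1.2.2 - this
      · simp only
        rcases abs_cases s with ⟨h, -⟩ | ⟨h, -⟩ <;> omega
    · rintro ⟨s, p, q, t⟩ hv
      have h1 := key hv
      simp [← h1]
  rw [h1, Finset.sum_product]
  refine Finset.sum_congr rfl ?_
  rintro ⟨e, f⟩ hx
  rw [mem_pairs] at hx
  obtain ⟨he, hf, h⟩ := hx
  refine sum_Icc_triWt he hf ((min_le_left _ _).trans ?_)
  nlinarith

lemma sum_triWt_two {m : ℤ} :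
    ∑ v ∈ sol m with (v.1 = v.2.1 ∨ v.1 = -v.2.1) ∧ v.2.1 = v.2.2.1, triWt v.2.1 v.2.2.1 v.2.2.2 =
      ∑ x ∈ pairs m, if 2 ∣ x.1 then 2 * triWt (x.1 / 2) (x.1 / 2) (x.2 - x.1 / 2) else 0 := by
  have key : ∀ {s p q t : ℤ}, (s, p, q, t) ∈ {v ∈ sol m | ((v.1 = v.2.1 ∨ v.1 = -v.2.1) ∧
      v.2.1 = v.2.2.1) ∧ triWt v.2.1 v.2.2.1 v.2.2.2 ≠ 0} →
      (s, p, q, t) ∈ sol m ∧ q = p ∧ 0 < p ∧ 0 ≤ t ∧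
        (s = p ∧ s.sign = 1 ∨ s = -p ∧ s.sign = -1) := by
    intro s p q t hv
    rw [Finset.mem_filter] at hv
    obtain ⟨h0, ⟨h1, h2⟩, h3⟩ := hv
    have := triWt_ne_zero h3
    simp only at h1 h2 this
    have := sign_cases3 s
    exact ⟨h0, by omega, by omega, by omega, by omega⟩
  have h1 : ∑ v ∈ sol m with (v.1 = v.2.1 ∨ v.1 = -v.2.1) ∧ v.2.1 = v.2.2.1,
      triWt v.2.1 v.2.2.1 v.2.2.2 =
      ∑ y ∈ pairs m ×ˢ ({1, -1} : Finset ℤ),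
        if 2 ∣ y.1.1 then triWt (y.1.1 / 2) (y.1.1 / 2) (y.1.2 - y.1.1 / 2) else 0 := by
    rw [← Finset.sum_filter_ne_zero, Finset.filter_filter]
    refine Finset.sum_of_injOn (fun v => ((v.2.1 + v.2.2.1, v.2.1 + v.2.2.2), v.1.sign)) ?_ ?_ ?_ ?_
    · rintro ⟨s, p, q, t⟩ hv ⟨s', p', q', t'⟩ hv' h
      have h1 := key hv
      have h2 := key hv'
      simp only [Prod.mk.injEq] at h ⊢
      omega
    · rintro ⟨s, p, q, t⟩ hv
      obtain ⟨h0, rfl, hp, ht, hs⟩ := key hv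
      rw [mem_sol] at h0
      simp only [Finset.mem_coe, Finset.mem_product, mem_pairs, Finset.mem_insert,
        Finset.mem_singleton]
      refine ⟨⟨by omega, by omega, ?_⟩, by omega⟩
      have : s ^ 2 = q ^ 2 := sq_eq_sq_iff_eq_or_eq_neg.2 (by omega)
      linear_combination h0.2 - this
    · rintro ⟨⟨e, f⟩, σ⟩ hy hn
      simp only [Finset.mem_product, mem_pairs, Finset.mem_insert, Finset.mem_singleton] at hy
      by_contra h0
      simp only [ite_eq_right_iff, Classical.not_imp] at h0
      obtain ⟨⟨b, rfl⟩, h0⟩ := h0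
      rw [show 2 * b / 2 = b by omega] at h0
      apply hn
      have hσ : σ * b = b ∨ σ * b = -b := by rcases hy.2 with rfl | rfl <;> simp
      refine ⟨(σ * b, b, b, f - b), ?_, ?_⟩
      · rw [Finset.mem_coe, Finset.mem_filter]
        refine ⟨mem_sol_of_triWt h0 ?_, ⟨hσ, rfl⟩, h0⟩
        have : (σ * b) ^ 2 = b ^ 2 := sq_eq_sq_iff_eq_or_eq_neg.2 hσ
        linear_combination this + hy.1.2.2
      · have hb : b.sign = 1 := Int.sign_eq_one_of_pos (by omega)
        simp only [Prod.mk.injEq]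
        refine ⟨⟨by ring, by ring⟩, ?_⟩
        rcases hy.2 with rfl | rfl <;> simp [hb]
    · rintro ⟨s, p, q, t⟩ hv
      obtain ⟨h0, rfl, hp, ht, hs⟩ := key hv
      simp only
      rw [if_pos (by omega), show (q + q) / 2 = q by omega, add_sub_cancel_left]
  rw [h1, Finset.sum_product]
  refine Finset.sum_congr rfl fun x _ => ?_
  rw [Finset.sum_pair (by norm_num)]
  simp only
  split_ifs <;> ring

lemma sum_triWt_three {m : ℤ} :
    ∑ v ∈ sol m with (v.1 = v.2.1 ∨ v.1 = -v.2.1) ∧ v.2.1 = v.2.2.1 ∧ v.2.1 = v.2.2.2,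
        triWt v.2.1 v.2.2.1 v.2.2.2 =
      ∑ x ∈ pairs m, if x.1 = x.2 ∧ 2 ∣ x.1 then 8 else 0 := by
  have key : ∀ {s p q t : ℤ}, (s, p, q, t) ∈ {v ∈ sol m | ((v.1 = v.2.1 ∨ v.1 = -v.2.1) ∧
      v.2.1 = v.2.2.1 ∧ v.2.1 = v.2.2.2) ∧ triWt v.2.1 v.2.2.1 v.2.2.2 ≠ 0} →
      (s, p, q, t) ∈ sol m ∧ q = p ∧ t = p ∧ 0 < p ∧
        (s = p ∧ s.sign = 1 ∨ s = -p ∧ s.sign = -1) := by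
    intro s p q t hv
    rw [Finset.mem_filter] at hv
    obtain ⟨h0, ⟨h1, h2⟩, h3⟩ := hv
    have := triWt_ne_zero h3
    simp only at h1 h2 this
    have := sign_cases3 s
    exact ⟨h0, by omega, by omega, by omega, by omega⟩
  have h1 : ∑ v ∈ sol m with (v.1 = v.2.1 ∨ v.1 = -v.2.1) ∧ v.2.1 = v.2.2.1 ∧ v.2.1 = v.2.2.2,
      triWt v.2.1 v.2.2.1 v.2.2.2 =
      ∑ y ∈ pairs m ×ˢ ({1, -1} : Finset ℤ), if y.1.1 = y.1.2 ∧ 2 ∣ y.1.1 then 4 else 0 := by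
    rw [← Finset.sum_filter_ne_zero, Finset.filter_filter]
    refine Finset.sum_of_injOn (fun v => ((v.2.1 + v.2.2.1, v.2.1 + v.2.2.2), v.1.sign)) ?_ ?_ ?_ ?_
    · rintro ⟨s, p, q, t⟩ hv ⟨s', p', q', t'⟩ hv' h
      have h1 := key hv
      have h2 := key hv'
      simp only [Prod.mk.injEq] at h ⊢
      omega
    · rintro ⟨s, p, q, t⟩ hv
      obtain ⟨h0, rfl, rfl, hp, hs⟩ := key hv
      rw [mem_sol] at h0
      simp only [Finset.mem_coe, Finset.mem_product, mem_pairs, Finset.mem_insert,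
        Finset.mem_singleton]
      refine ⟨⟨by omega, by omega, ?_⟩, by omega⟩
      have : s ^ 2 = t ^ 2 := sq_eq_sq_iff_eq_or_eq_neg.2 (by omega)
      linear_combination h0.2 - this
    · rintro ⟨⟨e, f⟩, σ⟩ hy hn
      simp only [Finset.mem_product, mem_pairs, Finset.mem_insert, Finset.mem_singleton] at hy
      by_contra h0
      simp only [ite_eq_right_iff, Classical.not_imp] at h0
      obtain ⟨⟨h2, ⟨b, rfl⟩⟩, -⟩ := h0
      obtain rfl : 2 * b = f := h2
      apply hn
      have hσ : σ * b = b ∨ σ * b = -b := by rcases hy.2 with rfl | rfl <;> simp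
      have hb : 0 < b := by omega
      have h0 : triWt b b b ≠ 0 := by rw [triWt_of_pos hb hb hb]; norm_num
      refine ⟨(σ * b, b, b, b), ?_, ?_⟩
      · rw [Finset.mem_coe, Finset.mem_filter]
        refine ⟨mem_sol_of_triWt h0 ?_, ⟨hσ, rfl, rfl⟩, h0⟩
        have : (σ * b) ^ 2 = b ^ 2 := sq_eq_sq_iff_eq_or_eq_neg.2 hσ
        linear_combination this + hy.1.2.2
      · have hb : b.sign = 1 := Int.sign_eq_one_of_pos (by omega)
        simp only [Prod.mk.injEq]
        refine ⟨⟨by ring, by ring⟩, ?_⟩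
        rcases hy.2 with rfl | rfl <;> simp [hb]
    · rintro ⟨s, p, q, t⟩ hv
      obtain ⟨h0, rfl, rfl, hp, hs⟩ := key hv
      simp only
      rw [triWt_of_pos hp hp hp, if_pos ⟨trivial, by omega⟩]
  rw [h1, Finset.sum_product]
  refine Finset.sum_congr rfl fun x _ => ?_
  rw [Finset.sum_pair (by norm_num)]
  simp only
  split_ifs <;> ring

lemma sum_pairs_swap (m : ℤ) (h : ℤ × ℤ → ℤ) : ∑ x ∈ pairs m, h x.swap = ∑ x ∈ pairs m, h x := by
  refine Finset.sum_nbij' Prod.swap Prod.swap ?_ ?_ ?_ ?_ ?_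
  · rintro ⟨e, f⟩ h
    rw [mem_pairs] at h
    exact mem_pairs.2 ⟨h.2.1, h.1, by linarith [h.2.2, mul_comm e f]⟩
  · rintro ⟨e, f⟩ h
    rw [mem_pairs] at h
    exact mem_pairs.2 ⟨h.2.1, h.1, by linarith [h.2.2, mul_comm e f]⟩
  · rintro ⟨e, f⟩ -; rfl
  · rintro ⟨e, f⟩ -; rfl
  · rintro ⟨e, f⟩ -; rfl

lemma sum_pairs_even (m : ℤ) :
    ∑ x ∈ pairs m, (if 2 ∣ x.1 then 4 * x.1 - 8 * x.2 else 0) = 0 := by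
  have h : ∑ x ∈ pairs m with 2 ∣ x.1, 4 * x.1 = ∑ x ∈ pairs m with 2 ∣ x.1, 8 * x.2 := by
    refine Finset.sum_nbij' (fun x => (2 * x.2, x.1 / 2)) (fun x => (2 * x.2, x.1 / 2))
      ?_ ?_ ?_ ?_ ?_
    · rintro ⟨e, f⟩ h
      rw [Finset.mem_filter, mem_pairs] at h
      obtain ⟨⟨h1, h2, h3⟩, b, rfl⟩ := h
      rw [Finset.mem_filter, mem_pairs]
      refine ⟨⟨by omega, by omega, ?_⟩, by simp⟩
      rw [show 2 * b / 2 = b by omega]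
      linarith
    · rintro ⟨e, f⟩ h
      rw [Finset.mem_filter, mem_pairs] at h
      obtain ⟨⟨h1, h2, h3⟩, b, rfl⟩ := h
      rw [Finset.mem_filter, mem_pairs]
      refine ⟨⟨by omega, by omega, ?_⟩, by simp⟩
      rw [show 2 * b / 2 = b by omega]
      linarith
    · rintro ⟨e, f⟩ h
      rw [Finset.mem_filter] at h
      simp only [Prod.mk.injEq] at h ⊢
      omega
    · rintro ⟨e, f⟩ h
      rw [Finset.mem_filter] at h
      simp only [Prod.mk.injEq] at h ⊢
      omega
    · rintro ⟨e, f⟩ h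
      rw [Finset.mem_filter] at h
      simp only at h ⊢
      omega
  rw [← Finset.sum_filter, Finset.sum_sub_distrib, h, sub_self]

lemma triWt_half {e f : ℤ} (he : 0 < e) (h2 : 2 ∣ e) :
    triWt (e / 2) (e / 2) (f - e / 2) = if e < 2 * f then 4 else if e = 2 * f then 2 else 0 := by
  obtain ⟨b, rfl⟩ := h2
  rw [show 2 * b / 2 = b by omega]
  rcases lt_trichotomy b f with h | h | h
  · rw [triWt_of_pos (by omega) (by omega) (by omega), if_pos (by omega)]
  · rw [show f - b = 0 by omega, triWt_zero (by omega) (by omega), if_neg (by omega),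
      if_pos (by omega)]
  · rw [if_neg (by omega), if_neg (by omega)]
    by_contra h0
    have := triWt_ne_zero h0
    omega

/-- The weighted number of solutions of `s ^ 2 + p q + q t + t p = m`. -/
lemma sum_triWt {m : ℤ} (hm : 0 < m) :
    ∑ v ∈ sol m, triWt v.2.1 v.2.2.1 v.2.2.2 =
      ∑ x ∈ pairs m, (16 * x.1 - 12 * (if 2 ∣ x.1 then x.1 else 0)
        + 16 * (if 2 ∣ x.1 ∧ 2 ∣ x.2 then x.1 else 0)
        - 12 * (if 2 ∣ x.1 - x.2 then min x.1 x.2 else 0) + 2 * (if x.1 = x.2 then 1 else 0)) := by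
  have h1 := sum_psi_split hm
  have h2 := sum_psi_full hm
  have h3 := sum_triWt_split m
  rw [h2, sum_psi_locus_s_eq_neg_q, sum_psi_locus_s_eq_p hm, sum_psi_locus_p_eq_neg_q hm] at h1
  rw [sum_triWt_one hm, sum_triWt_two, sum_triWt_three] at h3
  have h4 := sum_pairs_even m
  obtain ⟨K, hK⟩ : ∃ K : ℕ, 3 * m = (K : ℤ) := ⟨(3 * m).toNat, by omega⟩
  rw [hK] at h1
  have key : ∑ x ∈ pairs m, (2 * (∑ t ∈ Finset.Icc (-(K : ℤ)) K, gU x.1 x.2 t +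
        ∑ t ∈ Finset.Icc (-(K : ℤ)) K, gU x.1 (-x.2) t) + (if 2 ∣ x.1 - x.2 then
        (∑ t ∈ Finset.Icc (-(K : ℤ)) K, gW ((x.1 + x.2) / 2) ((x.1 - x.2) / 2) t +
        ∑ t ∈ Finset.Icc (-(K : ℤ)) K, gW ((x.1 - x.2) / 2) ((x.1 + x.2) / 2) t) else 0)
        + (16 * x.1 - 12 * (if 2 ∣ x.1 then x.1 else 0)
        + 16 * (if 2 ∣ x.1 ∧ 2 ∣ x.2 then x.1 else 0)
        - 12 * (if 2 ∣ x.1 - x.2 then min x.1 x.2 else 0) + 2 * (if x.1 = x.2 then 1 else 0))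
        + (if 2 ∣ x.1 then 4 * x.1 - 8 * x.2 else 0)
        - 3 * (8 * min x.1 x.2 - 6 + 4 * (if x.1 = x.2 then 0 else 1))
        + 3 * (if 2 ∣ x.1 then 2 * triWt (x.1 / 2) (x.1 / 2) (x.2 - x.1 / 2) else 0)
        - (if x.1 = x.2 ∧ 2 ∣ x.1 then 8 else 0)) = 0 := by
    rw [← mul_right_inj' (two_ne_zero (α := ℤ)), mul_zero, two_mul]
    nth_rw 1 [← sum_pairs_swap]
    rw [← Finset.sum_add_distrib]
    refine Finset.sum_eq_zero ?_
    rintro ⟨e, f⟩ hx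
    rw [mem_pairs] at hx
    obtain ⟨he, hf, hef⟩ := hx
    have hem : e ≤ m := by nlinarith
    have hfm : f ≤ m := by nlinarith
    simp only [Prod.swap]
    rw [sum_gU he hf K (by omega), sum_gU hf he K (by omega)]
    have w : ∀ {e f : ℤ}, 0 < e → 0 < f → e ≤ m → f ≤ m → (if 2 ∣ e - f then
        (∑ t ∈ Finset.Icc (-(K : ℤ)) K, gW ((e + f) / 2) ((e - f) / 2) t +
        ∑ t ∈ Finset.Icc (-(K : ℤ)) K, gW ((e - f) / 2) ((e + f) / 2) t) else 0) =
        if 2 ∣ e - f then (if f < e then -8 * e + 16 else if e = f then 4 * e - 4 else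
          16 * e - 16) else 0 := by
      intro e f he hf hem hfm
      split_ifs with h2 h3 h4
      · rw [sum_gW (by omega) (by omega) K (by omega), if_pos (by omega)]
        omega
      · rw [sum_gW (by omega) (by omega) K (by omega), if_neg (by omega), if_pos (by omega)]
        omega
      · rw [sum_gW (by omega) (by omega) K (by omega), if_neg (by omega), if_neg (by omega)]
        omega
      · rfl
    rw [w he hf hem hfm, w hf he hfm hem]
    have T : ∀ {e f : ℤ}, 0 < e → (if 2 ∣ e then 2 * triWt (e / 2) (e / 2) (f - e / 2) else 0) =
        if 2 ∣ e then (if e < 2 * f then 8 else if e = 2 * f then 4 else 0) else 0 := by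
      intro e f he
      split_ifs with h2 h3 h4 <;> first | rfl | (rw [triWt_half he h2]; simp [*])
    rw [T he, T hf]
    clear w T h1 h2 h3 h4
    have s1 := sign_cases3 (f - 2 * e)
    have s2 := sign_cases3 (e - 2 * f)
    have p1 : (2 ∣ f - e) ↔ (2 ∣ e - f) := by omega
    simp only [p1]
    generalize (f - 2 * e).sign = S1 at *
    generalize (e - 2 * f).sign = S2 at *
    have p2 : (2 ∣ e - f) ↔ ((2 ∣ e) ↔ (2 ∣ f)) := by omega
    simp only [p2]
    rcases lt_trichotomy e f with h | h | h
    · rw [min_eq_left h.le, min_eq_right h.le]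
      by_cases E : 2 ∣ e <;> by_cases F : 2 ∣ f <;>
        simp only [E, F, h.not_gt, h.ne, h.ne', h, if_true, if_false, and_true,
          and_false, iff_true, iff_false, not_true] <;> grind
    · subst h
      by_cases E : 2 ∣ e <;> simp only [E, lt_irrefl, if_true, if_false, min_self] <;> grind
    · rw [min_eq_left h.le, min_eq_right h.le]
      by_cases E : 2 ∣ e <;> by_cases F : 2 ∣ f <;>
        simp only [E, F, h.not_gt, h.ne, h.ne', h, if_true, if_false, and_true,
          and_false, iff_true, iff_false, not_true] <;> grind
  rw [Finset.sum_sub_distrib, Finset.sum_add_distrib, Finset.sum_sub_distrib,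
    Finset.sum_add_distrib, Finset.sum_add_distrib, Finset.sum_add_distrib, ← Finset.mul_sum,
    ← Finset.mul_sum, ← Finset.mul_sum, h4] at key
  linarith

lemma qfAct_mul (g h : Matrix.SpecialLinearGroup (Fin 2) ℤ) (Q : ℤ × ℤ × ℤ) :
    qfAct g (qfAct h Q) = qfAct (g * h) Q := by
  simp only [qfAct, Matrix.SpecialLinearGroup.coe_mul, Matrix.mul_apply, Fin.sum_univ_two]
  refine Prod.ext ?_ (Prod.ext ?_ ?_) <;> simp only <;> ring

lemma qfAct_one (Q : ℤ × ℤ × ℤ) : qfAct 1 Q = Q := by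
  simp [qfAct]

lemma qfRel_equivalence : Equivalence qfRel where
  refl Q := ⟨1, qfAct_one Q⟩
  symm := by
    rintro Q _ ⟨g, rfl⟩
    exact ⟨g⁻¹, by rw [qfAct_mul, inv_mul_cancel, qfAct_one]⟩
  trans := by
    rintro Q _ _ ⟨g, rfl⟩ ⟨h, rfl⟩
    exact ⟨h * g, (qfAct_mul h g Q).symm⟩

lemma mk_eq_mk_iff {Q Q' : ℤ × ℤ × ℤ} : Quot.mk qfRel Q = Quot.mk qfRel Q' ↔ qfRel Q Q' := by
  rw [Quot.eq, qfRel_equivalence.eqvGen_iff]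

lemma det_eq_one (g : Matrix.SpecialLinearGroup (Fin 2) ℤ) :
    g.1 0 0 * g.1 1 1 - g.1 0 1 * g.1 1 0 = 1 := by
  rw [← Matrix.det_fin_two, g.2]

lemma qfRel.exists {a b c a' b' c' : ℤ} (h : qfRel (a, b, c) (a', b', c')) :
    ∃ α β γ δ : ℤ, α * δ - β * γ = 1 ∧ a' = a * α ^ 2 + b * α * β + c * β ^ 2 ∧
      b' = 2 * a * α * γ + b * (α * δ + β * γ) + 2 * c * β * δ ∧
      c' = a * γ ^ 2 + b * γ * δ + c * δ ^ 2 := by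
  obtain ⟨g, hg⟩ := h
  simp only [qfAct, Prod.mk.injEq] at hg
  exact ⟨_, _, _, _, det_eq_one g, hg.1.symm, hg.2.1.symm, hg.2.2.symm⟩

lemma qfRel_of {a b c a' b' c' : ℤ} (α β γ δ : ℤ) (hd : α * δ - β * γ = 1)
    (ha : a' = a * α ^ 2 + b * α * β + c * β ^ 2)
    (hb : b' = 2 * a * α * γ + b * (α * δ + β * γ) + 2 * c * β * δ)
    (hc : c' = a * γ ^ 2 + b * γ * δ + c * δ ^ 2) : qfRel (a, b, c) (a', b', c') :=
  ⟨⟨!![α, β; γ, δ], by rw [Matrix.det_fin_two_of, hd]⟩, by simp [qfAct, ha, hb, hc]⟩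

lemma qfRel.disc_eq {a b c a' b' c' : ℤ} (h : qfRel (a, b, c) (a', b', c')) :
    b' ^ 2 - 4 * a' * c' = b ^ 2 - 4 * a * c := by
  obtain ⟨α, β, γ, δ, hd, rfl, rfl, rfl⟩ := h.exists
  linear_combination (b ^ 2 - 4 * a * c) * (α * δ - β * γ + 1) * hd

lemma qfRel.pos {a b c a' b' c' : ℤ} (h : qfRel (a, b, c) (a', b', c')) (ha : 0 < a)
    (hd : b ^ 2 - 4 * a * c < 0) : 0 < a' := by
  obtain ⟨α, β, γ, δ, hdet, rfl, -, -⟩ := h.exists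
  have key : 4 * a * (a * α ^ 2 + b * α * β + c * β ^ 2) =
      (2 * a * α + b * β) ^ 2 + (4 * a * c - b ^ 2) * β ^ 2 := by ring
  by_contra! h0
  have h1 : (4 * a * c - b ^ 2) * β ^ 2 ≤ 0 := by nlinarith [sq_nonneg (2 * a * α + b * β)]
  have hβ : β = 0 := by
    by_contra hβ
    have : 0 < β ^ 2 := by positivity
    nlinarith
  subst hβ
  have hα : α ≠ 0 := by rintro rfl; simp at hdet
  have : 0 < α ^ 2 := by positivity
  nlinarith

/-- Gauss-reduced forms `a x ^ 2 + 2 b x y + c y ^ 2`. -/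
def IsGaussReduced (a b c : ℤ) : Prop :=
  0 < a ∧ -a < 2 * b ∧ 2 * b ≤ a ∧ a ≤ c ∧ (a = c → 0 ≤ b)

lemma le_form {a b c x y : ℤ} (h : IsGaussReduced a b c) (hy : y ≠ 0) :
    c ≤ a * x ^ 2 + 2 * b * x * y + c * y ^ 2 := by
  obtain ⟨ha, h1, h2, h3, -⟩ := h
  have hy2 : 1 ≤ y ^ 2 := by have : 0 < y ^ 2 := by positivity
                             omega
  have hxy : 1 ≤ x ^ 2 - |x * y| + y ^ 2 := by
    have : 0 < x ^ 2 - |x * y| + y ^ 2 := by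
      rcases abs_cases (x * y) with ⟨h, -⟩ | ⟨h, -⟩ <;> rw [h]
      · nlinarith [sq_nonneg (2 * x - y)]
      · nlinarith [sq_nonneg (2 * x + y)]
    omega
  have hb : -(a * |x * y|) ≤ 2 * b * (x * y) := by
    have : |2 * b * (x * y)| ≤ a * |x * y| := by
      rw [abs_mul]
      exact mul_le_mul_of_nonneg_right (abs_le.2 ⟨by omega, by omega⟩) (abs_nonneg _)
    linarith [neg_abs_le (2 * b * (x * y))]
  nlinarith [mul_le_mul_of_nonneg_left hxy ha.le,
    mul_le_mul_of_nonneg_left hy2 (show 0 ≤ c - a by omega)]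

lemma IsGaussReduced.fst_le {a b c a' b' c' : ℤ} (h : IsGaussReduced a b c)
    (hr : qfRel (a, 2 * b, c) (a', 2 * b', c')) : a ≤ a' := by
  obtain ⟨α, β, γ, δ, hd, rfl, -, -⟩ := hr.exists
  by_cases hβ : β = 0
  · subst hβ
    have hα : α ≠ 0 := by rintro rfl; simp at hd
    have : 0 < α ^ 2 := by positivity
    nlinarith [h.1]
  · exact h.2.2.2.1.trans (le_form h hβ)

lemma IsGaussReduced.eq_or {a b c a' b' c' : ℤ} (h : IsGaussReduced a b c)
    (h' : IsGaussReduced a' b' c')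
    (hr : qfRel (a, 2 * b, c) (a', 2 * b', c')) : a = a' ∧ (b = b' ∨ a = c) := by
  have haa : a = a' :=
    le_antisymm (h.fst_le hr) (h'.fst_le (qfRel_equivalence.symm hr))
  refine ⟨haa, ?_⟩
  obtain ⟨α, β, γ, δ, hd, h1, h2, -⟩ := hr.exists
  by_cases hβ : β = 0
  · left
    subst hβ
    have hb : 2 * b' = 2 * (b + a * (α * γ)) := by linear_combination h2 + 2 * b * hd
    obtain ⟨h3, h4, h5, h6, h7⟩ := h
    obtain ⟨h3', h4', h5', h6', h7'⟩ := h'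
    generalize α * γ = k at hb
    have : k = 0 := by
      rcases lt_trichotomy k 0 with hk | hk | hk
      · nlinarith
      · exact hk
      · nlinarith
    subst this
    omega
  · right
    have := le_form (x := α) h hβ
    have := h.2.2.2.1
    omega

/-- Equivalent reduced forms coincide. -/
lemma IsGaussReduced.unique {a b c a' b' c' : ℤ} (h : IsGaussReduced a b c)
    (h' : IsGaussReduced a' b' c')
    (hr : qfRel (a, 2 * b, c) (a', 2 * b', c')) : a = a' ∧ b = b' ∧ c = c' := by
  have hd := hr.disc_eq
  obtain ⟨rfl, h1⟩ := h.eq_or h' hr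
  obtain ⟨-, h2⟩ := h'.eq_or h (qfRel_equivalence.symm hr)
  have ha := h.1
  have hb : b = b' := by
    rcases h1 with h1 | h1
    · exact h1
    rcases h2 with h2 | h2
    · exact h2.symm
    have h3 := h.2.2.2.2 h1
    have h4 := h'.2.2.2.2 h2
    rw [← h1, ← h2] at hd
    exact (pow_left_inj₀ h3 h4 two_ne_zero).1 (by linarith)
  refine ⟨rfl, hb, ?_⟩
  subst hb
  exact mul_left_cancel₀ ha.ne' (by linarith)

lemma exists_isGaussReduced {a b c : ℤ} (ha : 0 < a) (hd : 0 < a * c - b ^ 2) :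
    ∃ a' b' c', IsGaussReduced a' b' c' ∧ qfRel (a, 2 * b, c) (a', 2 * b', c') := by
  induction hn : a.toNat using Nat.strong_induction_on generalizing a b c with
  | _ n ih =>
    subst hn
    obtain ⟨k, hk1, hk2⟩ : ∃ k, -a < 2 * (b + a * k) ∧ 2 * (b + a * k) ≤ a := by
      refine ⟨-((2 * b + a - 1) / (2 * a)), ?_⟩
      have h1 := Int.emod_nonneg (2 * b + a - 1) (show 2 * a ≠ 0 by omega)
      have h2 := Int.emod_lt_of_pos (2 * b + a - 1) (show 0 < 2 * a by omega)
      have h3 := Int.mul_ediv_add_emod (2 * b + a - 1) (2 * a)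
      constructor <;> linarith
    have hr : qfRel (a, 2 * b, c) (a, 2 * (b + a * k), a * k ^ 2 + 2 * b * k + c) :=
      qfRel_of 1 0 k 1 (by ring) (by ring) (by ring) (by ring)
    have hd' : 0 < a * (a * k ^ 2 + 2 * b * k + c) - (b + a * k) ^ 2 := by linarith
    generalize b + a * k = b₁ at *
    generalize a * k ^ 2 + 2 * b * k + c = c₁ at *
    have hs : qfRel (a, 2 * b₁, c₁) (c₁, 2 * -b₁, a) :=
      qfRel_of 0 1 (-1) 0 (by ring) (by ring) (by ring) (by ring)
    have hc : 0 < c₁ := by nlinarith [sq_nonneg b₁]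
    rcases lt_trichotomy a c₁ with h | h | h
    · exact ⟨a, b₁, c₁, ⟨ha, hk1, hk2, h.le, fun h' => absurd h' h.ne⟩, hr⟩
    · subst h
      rcases le_or_gt 0 b₁ with h0 | h0
      · exact ⟨a, b₁, a, ⟨ha, hk1, hk2, le_rfl, fun _ => h0⟩, hr⟩
      · exact ⟨a, -b₁, a, ⟨ha, by omega, by omega, le_rfl, fun _ => by omega⟩,
          qfRel_equivalence.trans hr hs⟩
    · obtain ⟨a', b', c', h1, h2⟩ := ih c₁.toNat (by omega) hc
        (show 0 < c₁ * a - (-b₁) ^ 2 by linarith) rfl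
      exact ⟨a', b', c', h1, qfRel_equivalence.trans (qfRel_equivalence.trans hr hs) h2⟩

instance (a b c : ℤ) : Decidable (IsGaussReduced a b c) := by
  unfold IsGaussReduced; infer_instance

/-- The Gauss-reduced forms `a x ^ 2 + 2 b x y + c y ^ 2` of discriminant `-4 n`. -/
noncomputable def reducedForms (n : ℤ) : Finset (ℤ × ℤ × ℤ) :=
  {v ∈ Finset.Icc (-(2 * n)) (2 * n) ×ˢ Finset.Icc (-(2 * n)) (2 * n) ×ˢ
    Finset.Icc (-(2 * n)) (2 * n) |
      IsGaussReduced v.1 v.2.1 v.2.2 ∧ v.1 * v.2.2 - v.2.1 ^ 2 = n}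

lemma mem_reducedForms {n a b c : ℤ} :
    (a, b, c) ∈ reducedForms n ↔ IsGaussReduced a b c ∧ a * c - b ^ 2 = n := by
  simp only [reducedForms, Finset.mem_filter, Finset.mem_product, Finset.mem_Icc,
    and_iff_right_iff_imp]
  rintro ⟨⟨ha, h1, h2, h3, -⟩, h⟩
  have hb : 4 * b ^ 2 ≤ a * a := by nlinarith
  have hc : c ≤ a * c := by nlinarith
  have hac : a * a ≤ a * c := by nlinarith
  have hn : c ≤ 2 * n := by linarith
  omega

/-- The class of `a x ^ 2 + 2 b x y + c y ^ 2`. -/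
def evenClass (v : ℤ × ℤ × ℤ) : Quot qfRel := Quot.mk qfRel (v.1, 2 * v.2.1, v.2.2)

lemma evenClass_injOn (n : ℤ) : Set.InjOn evenClass (reducedForms n) := by
  rintro ⟨a, b, c⟩ h ⟨a', b', c'⟩ h' hh
  rw [Finset.mem_coe, mem_reducedForms] at h h'
  obtain ⟨rfl, rfl, rfl⟩ := h.1.unique h'.1 (mk_eq_mk_iff.1 hh)
  rfl

lemma qfClasses_eq_image {n : ℤ} (hn : 0 < n) :
    qfClasses (4 * n) = evenClass '' (reducedForms n : Set (ℤ × ℤ × ℤ)) := by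
  ext q
  constructor
  · rintro ⟨⟨a, B, c⟩, rfl, hd, ha⟩
    simp only at hd ha
    have hB : Even (B ^ 2) := ⟨2 * (a * c - n), by linarith⟩
    obtain ⟨b, rfl⟩ : 2 ∣ B := even_iff_two_dvd.1 ((Int.even_pow' two_ne_zero).1 hB)
    obtain ⟨a', b', c', h, hr⟩ := exists_isGaussReduced (b := b) (c := c) ha (by linarith)
    have := hr.disc_eq
    refine ⟨(a', b', c'), ?_, (mk_eq_mk_iff.2 hr).symm⟩
    rw [Finset.mem_coe, mem_reducedForms]
    exact ⟨h, by linarith⟩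
  · rintro ⟨⟨a, b, c⟩, h, rfl⟩
    rw [Finset.mem_coe, mem_reducedForms] at h
    exact ⟨(a, 2 * b, c), rfl, by simp only; linarith, h.1.1⟩

/-- Classes meeting a one-parameter family of forms, described on the reduced forms. -/
lemma sep_qfClasses_eq_image {n : ℤ} (hn : 0 < n) (f : ℤ → ℤ × ℤ × ℤ) (P : ℤ × ℤ × ℤ → Prop)
    (h1 : ∀ a b c, IsGaussReduced a b c → P (a, b, c) → ∃ k, f k = (a, 2 * b, c))
    (h2 : ∀ k, 0 < (f k).1 → (f k).2.1 ^ 2 - 4 * (f k).1 * (f k).2.2 = -(4 * n) →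
      ∃ a b c, f k = (a, 2 * b, c) ∧ IsGaussReduced a b c ∧ P (a, b, c)) :
    {q ∈ qfClasses (4 * n) | ∃ k : ℤ, Quot.mk qfRel (f k) = q} =
      evenClass '' {v | v ∈ reducedForms n ∧ P v} := by
  rw [qfClasses_eq_image hn]
  ext q
  constructor
  · rintro ⟨⟨⟨a, b, c⟩, h, rfl⟩, k, hk⟩
    rw [Finset.mem_coe, mem_reducedForms] at h
    have hr : qfRel (a, 2 * b, c) (f k) := qfRel_equivalence.symm (mk_eq_mk_iff.1 hk)
    obtain ⟨a', b', c', h3, h4, h5⟩ := h2 k (hr.pos h.1.1 (by linarith))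
      (hr.disc_eq.trans (by linarith))
    rw [h3] at hr
    obtain ⟨rfl, rfl, rfl⟩ := h.1.unique h4 hr
    exact ⟨(a, b, c), ⟨mem_reducedForms.2 h, h5⟩, rfl⟩
  · rintro ⟨⟨a, b, c⟩, ⟨h, hP⟩, rfl⟩
    refine ⟨⟨_, h, rfl⟩, ?_⟩
    obtain ⟨k, hk⟩ := h1 a b c (mem_reducedForms.1 h).1 hP
    exact ⟨k, by rw [hk]; rfl⟩

lemma twelve_mul_hurwitzH {n : ℤ} (hn : 0 < n) :
    12 * hurwitzH (4 * n) = ((∑ v ∈ reducedForms n,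
      (12 - 6 * (if v.2.1 = 0 ∧ v.1 = v.2.2 then 1 else 0)
        - 8 * (if v.1 = 2 * v.2.1 ∧ v.1 = v.2.2 then 1 else 0)) : ℤ) : ℝ) := by
  rw [hurwitzH, if_neg (by omega), if_pos (by omega)]
  rw [sep_qfClasses_eq_image hn (fun k => (k, 0, k)) (fun v => v.2.1 = 0 ∧ v.1 = v.2.2),
    sep_qfClasses_eq_image hn (fun k => (k, k, k)) (fun v => v.1 = 2 * v.2.1 ∧ v.1 = v.2.2),
    qfClasses_eq_image hn, Set.InjOn.ncard_image (evenClass_injOn n),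
    Set.InjOn.ncard_image ((evenClass_injOn n).mono fun v hv => hv.1),
    Set.InjOn.ncard_image ((evenClass_injOn n).mono fun v hv => hv.1), Set.ncard_coe_finset]
  · rw [← Finset.coe_filter, ← Finset.coe_filter, Set.ncard_coe_finset, Set.ncard_coe_finset,
      Finset.sum_sub_distrib, Finset.sum_sub_distrib, ← Finset.mul_sum, ← Finset.mul_sum,
      Finset.sum_boole, Finset.sum_boole]
    simp only [Finset.sum_const, nsmul_eq_mul]
    push_cast
    ring
  · rintro a b c - ⟨h, h'⟩
    simp only at h h'
    exact ⟨a, by rw [← h, h']⟩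
  · intro k hk h
    simp only at hk h
    obtain ⟨b, rfl⟩ : 2 ∣ k := by
      have : Even (k ^ 2) := by
        by_contra h0
        rw [Int.not_even_iff_odd, Int.odd_pow' two_ne_zero] at h0
        obtain ⟨j, rfl⟩ := h0
        ring_nf at h
        omega
      exact even_iff_two_dvd.1 ((Int.even_pow' two_ne_zero).1 this)
    refine ⟨2 * b, b, 2 * b, rfl, ?_, rfl, rfl⟩
    unfold IsGaussReduced; omega
  · rintro a b c - ⟨h, h'⟩
    simp only at h h'
    exact ⟨a, by rw [h, ← h', mul_zero]⟩
  · intro k hk h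
    simp only at hk h
    refine ⟨k, 0, k, rfl, ?_, rfl, rfl⟩
    unfold IsGaussReduced; omega

/-- Solutions of `p q + q t + t p = n` in a box. -/
noncomputable def triples (K n : ℤ) : Finset (ℤ × ℤ × ℤ) :=
  {v ∈ Finset.Icc (-K) K ×ˢ Finset.Icc (-K) K ×ˢ Finset.Icc (-K) K |
    v.1 * v.2.1 + v.2.1 * v.2.2 + v.2.2 * v.1 = n}

lemma mem_triples {K n p q t : ℤ} : (p, q, t) ∈ triples K n ↔
    ((-K ≤ p ∧ p ≤ K) ∧ (-K ≤ q ∧ q ≤ K) ∧ (-K ≤ t ∧ t ≤ K)) ∧ p * q + q * t + t * p = n := by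
  simp [triples]

lemma sum_triples_rot (K n : ℤ) (h : ℤ → ℤ → ℤ → ℤ) :
    ∑ v ∈ triples K n, h v.1 v.2.1 v.2.2 = ∑ v ∈ triples K n, h v.2.1 v.2.2 v.1 := by
  refine Finset.sum_nbij' (fun v => (v.2.2, v.1, v.2.1)) (fun v => (v.2.1, v.2.2, v.1))
    ?_ ?_ ?_ ?_ ?_
  · rintro ⟨p, q, t⟩ hv
    rw [mem_triples] at hv ⊢
    exact ⟨by simp only; omega, by linear_combination hv.2⟩
  · rintro ⟨p, q, t⟩ hv
    rw [mem_triples] at hv ⊢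
    exact ⟨by simp only; omega, by linear_combination hv.2⟩
  · rintro ⟨p, q, t⟩ -; rfl
  · rintro ⟨p, q, t⟩ -; rfl
  · rintro ⟨p, q, t⟩ -; rfl

lemma sum_triples_swap (K n : ℤ) (h : ℤ → ℤ → ℤ → ℤ) :
    ∑ v ∈ triples K n, h v.1 v.2.1 v.2.2 = ∑ v ∈ triples K n, h v.2.1 v.1 v.2.2 := by
  refine Finset.sum_nbij' (fun v => (v.2.1, v.1, v.2.2)) (fun v => (v.2.1, v.1, v.2.2))
    ?_ ?_ ?_ ?_ ?_
  · rintro ⟨p, q, t⟩ hv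
    rw [mem_triples] at hv ⊢
    exact ⟨by simp only; omega, by linear_combination hv.2⟩
  · rintro ⟨p, q, t⟩ hv
    rw [mem_triples] at hv ⊢
    exact ⟨by simp only; omega, by linear_combination hv.2⟩
  · rintro ⟨p, q, t⟩ -; rfl
  · rintro ⟨p, q, t⟩ -; rfl
  · rintro ⟨p, q, t⟩ -; rfl

/-- Number of distinct permutations of a sorted triple, and zero on other triples. -/
def sortedMult (p q t : ℤ) : ℤ :=
  if t ≤ p ∧ p ≤ q then (if t = p ∧ p = q then 1 else if t = p ∨ p = q then 3 else 6) else 0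

lemma triWt_swap (p q t : ℤ) : triWt q p t = triWt p q t := by
  unfold triWt
  rw [show q * p + p * t + t * q = p * q + q * t + t * p by ring]
  congr 1
  · apply propext; tauto
  · congr 1
    apply propext; tauto

lemma sortedMult_symm (p q t : ℤ) : sortedMult p q t + sortedMult q t p + sortedMult t p q +
    sortedMult q p t + sortedMult p t q + sortedMult t q p = 6 := by
  unfold sortedMult
  rcases lt_trichotomy p q with h | h | h <;> rcases lt_trichotomy q t with h' | h' | h' <;>
    rcases lt_trichotomy p t with h'' | h'' | h'' <;> grind

lemma sum_triWt_sorted (K n : ℤ) :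
    ∑ v ∈ triples K n, triWt v.1 v.2.1 v.2.2 =
      ∑ v ∈ triples K n, triWt v.1 v.2.1 v.2.2 * sortedMult v.1 v.2.1 v.2.2 := by
  have r1 := sum_triples_rot K n fun p q t => triWt p q t * sortedMult p q t
  have r2 := sum_triples_rot K n fun p q t => triWt q t p * sortedMult q t p
  have r3 := sum_triples_swap K n fun p q t => triWt p q t * sortedMult p q t
  have r4 := sum_triples_rot K n fun p q t => triWt q p t * sortedMult q p t
  have r5 := sum_triples_rot K n fun p q t => triWt t q p * sortedMult t q p
  have h : 6 * ∑ v ∈ triples K n, triWt v.1 v.2.1 v.2.2 =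
      ∑ v ∈ triples K n, (triWt v.1 v.2.1 v.2.2 * sortedMult v.1 v.2.1 v.2.2
        + triWt v.2.1 v.2.2 v.1 * sortedMult v.2.1 v.2.2 v.1
        + triWt v.2.2 v.1 v.2.1 * sortedMult v.2.2 v.1 v.2.1
        + triWt v.2.1 v.1 v.2.2 * sortedMult v.2.1 v.1 v.2.2
        + triWt v.2.2 v.2.1 v.1 * sortedMult v.2.2 v.2.1 v.1
        + triWt v.1 v.2.2 v.2.1 * sortedMult v.1 v.2.2 v.2.1) := by
    rw [Finset.mul_sum]
    refine Finset.sum_congr rfl ?_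
    rintro ⟨p, q, t⟩ -
    simp only
    rw [triWt_rot p q t, ← triWt_rot t p q, triWt_swap p q t, triWt_rot q p t,
      ← triWt_rot t q p, triWt_swap p q t]
    linear_combination -triWt p q t * sortedMult_symm p q t
  simp only [Finset.sum_add_distrib] at h
  linarith

lemma sum_reducedForms {n K : ℤ} (hn : 0 < n) (hK : n ≤ K) :
    ∑ v ∈ reducedForms n, (12 - 6 * (if v.2.1 = 0 ∧ v.1 = v.2.2 then 1 else 0)
        - 8 * (if v.1 = 2 * v.2.1 ∧ v.1 = v.2.2 then 1 else 0)) =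
      ∑ v ∈ triples K n, triWt v.1 v.2.1 v.2.2 := by
  have bound {p q t : ℤ} (h0 : 0 ≤ t) (h1 : t ≤ p) (h2 : p ≤ q) (h : p * q + q * t + t * p = n) :
      (p, q, t) ∈ triples K n ∧ 0 < p := by
    have hp : 0 < p := by
      by_contra! hp
      obtain rfl : t = 0 := by omega
      obtain rfl : p = 0 := by omega
      simp at h
      omega
    have : 0 ≤ q * t := mul_nonneg (by omega) h0
    have : 0 ≤ t * p := mul_nonneg h0 hp.le
    have : q ≤ p * q := by nlinarith
    exact ⟨mem_triples.2 ⟨by omega, h⟩, hp⟩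
  rw [sum_triWt_sorted, ← Finset.sum_filter_add_sum_filter_not _ (fun v => 0 ≤ v.2.1)]
  have e1 : ∑ v ∈ reducedForms n with 0 ≤ v.2.1,
      ((12 : ℤ) - 6 * (if v.2.1 = 0 ∧ v.1 = v.2.2 then 1 else 0)
        - 8 * (if v.1 = 2 * v.2.1 ∧ v.1 = v.2.2 then 1 else 0)) =
      ∑ v ∈ triples K n with 0 ≤ v.2.2 ∧ v.2.2 ≤ v.1 ∧ v.1 ≤ v.2.1,
        ((12 : ℤ) - 6 * (if v.2.2 = 0 ∧ v.1 = v.2.1 then 1 else 0)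
        - 8 * (if v.1 = v.2.2 ∧ v.1 = v.2.1 then 1 else 0)) := by
    refine Finset.sum_nbij' (fun v => (v.1 - v.2.1, v.2.2 - v.2.1, v.2.1))
      (fun v => (v.1 + v.2.2, v.2.2, v.2.1 + v.2.2)) ?_ ?_ ?_ ?_ ?_
    · rintro ⟨a, b, c⟩ hv
      rw [Finset.mem_filter, mem_reducedForms] at hv
      obtain ⟨⟨⟨h1, h2, h3, h4, h5⟩, h6⟩, h7⟩ := hv
      simp only at h7
      rw [Finset.mem_filter]
      exact ⟨(bound (p := a - b) (q := c - b) h7 (by omega) (by omega) (by linarith)).1, h7,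
        by simp only; omega, by simp only; omega⟩
    · rintro ⟨p, q, t⟩ hv
      rw [Finset.mem_filter, mem_triples] at hv
      obtain ⟨⟨-, h1⟩, h2, h3, h4⟩ := hv
      simp only at h2 h3 h4
      have hp := (bound h2 h3 h4 h1).2
      rw [Finset.mem_filter, mem_reducedForms, IsGaussReduced]
      exact ⟨⟨by simp only; omega, by linarith⟩, h2⟩
    · rintro ⟨a, b, c⟩ -; simp
    · rintro ⟨p, q, t⟩ -; simp
    · rintro ⟨a, b, c⟩ -
      simp only
      split_ifs <;> omega
  have e2 : ∑ v ∈ reducedForms n with ¬ 0 ≤ v.2.1,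
      ((12 : ℤ) - 6 * (if v.2.1 = 0 ∧ v.1 = v.2.2 then 1 else 0)
        - 8 * (if v.1 = 2 * v.2.1 ∧ v.1 = v.2.2 then 1 else 0)) =
      ∑ v ∈ triples K n with 0 < v.2.2 ∧ v.2.2 < v.1 ∧ v.1 < v.2.1, (12 : ℤ) := by
    refine Finset.sum_nbij' (fun v => (v.1 + v.2.1, v.2.2 + v.2.1, -v.2.1))
      (fun v => (v.1 + v.2.2, -v.2.2, v.2.1 + v.2.2)) ?_ ?_ ?_ ?_ ?_
    · rintro ⟨a, b, c⟩ hv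
      rw [Finset.mem_filter, mem_reducedForms] at hv
      obtain ⟨⟨⟨h1, h2, h3, h4, h5⟩, h6⟩, h7⟩ := hv
      simp only at h7
      rw [Finset.mem_filter]
      exact ⟨(bound (p := a + b) (q := c + b) (t := -b) (by omega) (by omega) (by omega)
        (by linarith)).1, by simp only; omega, by simp only; omega, by simp only; omega⟩
    · rintro ⟨p, q, t⟩ hv
      rw [Finset.mem_filter, mem_triples] at hv
      obtain ⟨⟨-, h1⟩, h2, h3, h4⟩ := hv
      simp only at h2 h3 h4
      rw [Finset.mem_filter, mem_reducedForms, IsGaussReduced]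
      exact ⟨⟨by simp only; omega, by linarith⟩, by simp only; omega⟩
    · rintro ⟨a, b, c⟩ -; simp
    · rintro ⟨p, q, t⟩ -; simp
    · rintro ⟨a, b, c⟩ hv
      rw [Finset.mem_filter, mem_reducedForms, IsGaussReduced] at hv
      simp only at hv ⊢
      rw [if_neg (by omega), if_neg (by omega)]
      norm_num
  rw [e1, e2, Finset.sum_filter, Finset.sum_filter, ← Finset.sum_add_distrib]
  refine Finset.sum_congr rfl ?_
  rintro ⟨p, q, t⟩ hv
  rw [mem_triples] at hv
  simp only [triWt, sortedMult, hv.2, hn, and_true]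
  by_cases h0 : 0 ≤ t ∧ t ≤ p ∧ p ≤ q
  · have hp := (bound h0.1 h0.2.1 h0.2.2 hv.2).2
    split_ifs <;> omega
  · rw [if_neg h0, if_neg (by omega)]
    split_ifs <;> omega

lemma hurwitzH_of_neg {n : ℤ} (hn : n < 0) : hurwitzH n = 0 := by
  rw [hurwitzH, if_neg hn.ne, if_neg (by omega)]

lemma twelve_mul_hurwitzH_sub_sq {m : ℤ} (hm : 0 < m) (s : ℤ) :
    12 * hurwitzH (4 * m - (2 * s) ^ 2) =
      ((∑ v ∈ triples (3 * m) (m - s ^ 2), triWt v.1 v.2.1 v.2.2 -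
        (if s ^ 2 = m then 1 else 0) : ℤ) : ℝ) := by
  have h0 : ¬ 0 < m - s ^ 2 →
      ∑ v ∈ triples (3 * m) (m - s ^ 2), triWt v.1 v.2.1 v.2.2 = 0 := by
    intro h
    refine Finset.sum_eq_zero ?_
    rintro ⟨p, q, t⟩ hv
    rw [mem_triples] at hv
    simp only [triWt]
    rw [if_neg (by rw [hv.2]; tauto)]
  rw [show 4 * m - (2 * s) ^ 2 = 4 * (m - s ^ 2) by ring]
  rcases lt_trichotomy (s ^ 2) m with h | h | h
  · rw [twelve_mul_hurwitzH (by omega), if_neg h.ne,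
      sum_reducedForms (K := 3 * m) (by omega) (by linarith [sq_nonneg s]), sub_zero]
  · rw [h0 (by omega), if_pos h, h]
    simp [hurwitzH]
  · rw [h0 (by omega), if_neg h.ne', hurwitzH_of_neg (by omega)]
    simp

lemma sum_sol_eq_sum_triples (m : ℤ) :
    ∑ v ∈ sol m, triWt v.2.1 v.2.2.1 v.2.2.2 = ∑ s ∈ Finset.Icc (-(3 * m)) (3 * m),
      ∑ v ∈ triples (3 * m) (m - s ^ 2), triWt v.1 v.2.1 v.2.2 := by
  rw [Finset.sum_sigma']
  refine Finset.sum_nbij' (fun v => ⟨v.1, v.2⟩) (fun v => (v.1, v.2)) ?_ ?_ ?_ ?_ ?_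
  · rintro ⟨s, p, q, t⟩ hv
    rw [mem_sol] at hv
    simp only [Finset.mem_sigma, Finset.mem_Icc, mem_triples]
    exact ⟨hv.1.1, hv.1.2, by linarith [hv.2]⟩
  · rintro ⟨s, p, q, t⟩ hv
    simp only [Finset.mem_sigma, Finset.mem_Icc, mem_triples] at hv
    rw [mem_sol]
    exact ⟨⟨hv.1, hv.2.1⟩, by linarith [hv.2.2]⟩
  · rintro ⟨s, p, q, t⟩ -; rfl
  · rintro ⟨s, p, q, t⟩ -; rfl
  · rintro ⟨s, p, q, t⟩ -; rfl

lemma sum_sq_eq {m : ℤ} (hm : 0 < m) :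
    ∑ s ∈ Finset.Icc (-(3 * m)) (3 * m), (if s ^ 2 = m then 1 else 0 : ℤ) =
      ∑ x ∈ pairs m, 2 * (if x.1 = x.2 then 1 else 0) := by
  have h1 : ∑ s ∈ Finset.Icc (-(3 * m)) (3 * m), (if s ^ 2 = m then 1 else 0 : ℤ) =
      ∑ y ∈ pairs m ×ˢ ({1, -1} : Finset ℤ), if y.1.1 = y.1.2 then 1 else 0 := by
    rw [← Finset.sum_filter, ← Finset.sum_filter]
    refine Finset.sum_nbij' (fun s => ((|s|, |s|), s.sign)) (fun y => y.2 * y.1.1) ?_ ?_ ?_ ?_ ?_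
    · intro s hs
      rw [Finset.mem_filter] at hs
      have h0 : s ≠ 0 := by rintro rfl; simp at hs; omega
      simp only [Finset.mem_filter, Finset.mem_product, mem_pairs, Finset.mem_insert,
        Finset.mem_singleton, and_true]
      refine ⟨⟨abs_pos.2 h0, abs_pos.2 h0, by rw [abs_mul_abs_self]; linarith [hs.2]⟩, ?_⟩
      have := sign_cases h0
      omega
    · rintro ⟨⟨e, f⟩, σ⟩ hy
      simp only [Finset.mem_filter, Finset.mem_product, mem_pairs, Finset.mem_insert,
        Finset.mem_singleton] at hy
      obtain ⟨⟨⟨h1, h2, h3⟩, h4⟩, rfl⟩ := hy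
      have : e ≤ m := by nlinarith
      rw [Finset.mem_filter, Finset.mem_Icc]
      rcases h4 with rfl | rfl
      · exact ⟨by simp only; omega, by linarith⟩
      · exact ⟨by simp only; omega, by linarith⟩
    · intro s _
      exact Int.sign_mul_abs s
    · rintro ⟨⟨e, f⟩, σ⟩ hy
      simp only [Finset.mem_filter, Finset.mem_product, mem_pairs, Finset.mem_insert,
        Finset.mem_singleton] at hy
      obtain ⟨⟨⟨h1, h2, h3⟩, h4⟩, rfl⟩ := hy
      have hs := Int.sign_eq_one_of_pos h1
      rcases h4 with rfl | rfl <;> simp [abs_of_pos h1, hs]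
    · intro s _; rfl
  rw [h1, Finset.sum_product]
  refine Finset.sum_congr rfl fun x _ => ?_
  rw [Finset.sum_pair (by norm_num), two_mul]

/-- The parametrization of the solutions of `b ^ 2 - a ^ 2 = m` by factorizations of `m`. -/
def diffSq (y : (ℤ × ℤ) × ℤ) : ℤ × ℤ :=
  (y.2 * ((y.1.2 - y.1.1) / 2), y.2 * ((y.1.2 + y.1.1) / 2))

lemma mem_factors_iff {m e f σ : ℤ} :
    ((e, f), σ) ∈ {x ∈ pairs m | 2 ∣ x.1 - x.2} ×ˢ ({1, -1} : Finset ℤ) ↔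
      (0 < e ∧ 0 < f ∧ e * f = m) ∧ 2 ∣ e - f ∧ (σ = 1 ∨ σ = -1) := by
  simp [mem_pairs, and_assoc]

lemma setOf_sq_sub_sq_eq {m : ℤ} (hm : 0 < m) :
    {p : ℤ × ℤ | p.2 ^ 2 - p.1 ^ 2 = m} =
      (({x ∈ pairs m | 2 ∣ x.1 - x.2} ×ˢ ({1, -1} : Finset ℤ)).image diffSq : Finset (ℤ × ℤ)) := by
  ext ⟨a, b⟩
  rw [Finset.coe_image, Set.mem_image]
  constructor
  · intro h
    have h : (b - a) * (b + a) = m := by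
      have : b ^ 2 - a ^ 2 = m := h
      linarith
    rcases lt_or_ge 0 (b - a) with h' | h'
    · have h'' : 0 < b + a := (mul_pos_iff_of_pos_left h').1 (h.symm ▸ hm)
      refine ⟨((b - a, b + a), 1), ?_, ?_⟩
      · rw [Finset.mem_coe, mem_factors_iff]
        exact ⟨⟨h', h'', h⟩, by omega, by simp⟩
      · simp only [diffSq, Prod.mk.injEq]
        omega
    · have h'' : b + a < 0 := by
        by_contra! h0
        nlinarith
      have h''' : b - a < 0 := by
        by_contra! h0
        nlinarith
      refine ⟨((-(b - a), -(b + a)), -1), ?_, ?_⟩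
      · rw [Finset.mem_coe, mem_factors_iff]
        exact ⟨⟨by omega, by omega, by linarith⟩, by omega, by simp⟩
      · simp only [diffSq, Prod.mk.injEq]
        omega
  · rintro ⟨⟨⟨e, f⟩, σ⟩, hy, h⟩
    rw [Finset.mem_coe, mem_factors_iff] at hy
    obtain ⟨⟨-, -, h1⟩, ⟨k, hk⟩, h2⟩ := hy
    obtain rfl : e = f + 2 * k := by omega
    simp only [diffSq, Prod.mk.injEq] at h
    rw [show (f - (f + 2 * k)) / 2 = -k by omega,
      show (f + (f + 2 * k)) / 2 = f + k by omega] at h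
    obtain ⟨rfl, rfl⟩ := h
    have : σ ^ 2 = 1 := sq_eq_one_iff.2 h2
    change (σ * (f + k)) ^ 2 - (σ * -k) ^ 2 = m
    linear_combination h1 + ((f + k) ^ 2 - k ^ 2) * this

lemma finsum_min_abs {m : ℤ} (hm : 0 < m) :
    ∑ᶠ p ∈ {p : ℤ × ℤ | p.2 ^ 2 - p.1 ^ 2 = m}, ((min |p.1 + p.2| |p.1 - p.2| : ℤ) : ℝ) =
      ((2 * ∑ x ∈ pairs m, if 2 ∣ x.1 - x.2 then min x.1 x.2 else 0 : ℤ) : ℝ) := by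
  rw [setOf_sq_sub_sq_eq hm, finsum_mem_coe_finset, ← Int.cast_sum]
  congr 1
  rw [Finset.sum_image, ← Finset.sum_filter, Finset.mul_sum, Finset.sum_product]
  · refine Finset.sum_congr rfl ?_
    rintro ⟨e, f⟩ hx
    rw [Finset.mem_filter, mem_pairs] at hx
    obtain ⟨⟨h1, h2, -⟩, h3⟩ := hx
    simp only at h3
    rw [Finset.sum_pair (by norm_num)]
    simp only [diffSq]
    rw [show 1 * ((f - e) / 2) + 1 * ((f + e) / 2) = f by omega,
      show 1 * ((f - e) / 2) - 1 * ((f + e) / 2) = -e by omega,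
      show -1 * ((f - e) / 2) + -1 * ((f + e) / 2) = -f by omega,
      show -1 * ((f - e) / 2) - -1 * ((f + e) / 2) = e by omega,
      abs_neg, abs_neg, abs_of_pos h1, abs_of_pos h2, min_comm f e, two_mul]
  · rintro ⟨⟨e, f⟩, σ⟩ hy ⟨⟨e', f'⟩, σ'⟩ hy' h
    rw [Finset.mem_coe, mem_factors_iff] at hy hy'
    simp only [diffSq, Prod.mk.injEq] at h ⊢
    obtain ⟨h1, h2, h3 | h3⟩ := hy <;> obtain ⟨h1', h2', h3' | h3'⟩ := hy' <;> subst h3 h3' <;>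
      omega

lemma sum_pairs_fst {n : ℕ} (hn : 0 < n) :
    ((∑ x ∈ pairs n, x.1 : ℤ) : ℝ) = ∑ d ∈ n.divisors, (d : ℝ) := by
  have h : ∑ x ∈ pairs n, x.1 = ∑ d ∈ n.divisors, (d : ℤ) := by
    refine Finset.sum_nbij' (fun x => x.1.toNat) (fun d => ((d : ℤ), ((n / d : ℕ) : ℤ)))
      ?_ ?_ ?_ ?_ ?_
    · rintro ⟨e, f⟩ hx
      rw [mem_pairs] at hx
      obtain ⟨h1, h2, h3⟩ := hx
      rw [Nat.mem_divisors]
      refine ⟨?_, hn.ne'⟩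
      rw [← Int.natCast_dvd_natCast, Int.toNat_of_nonneg h1.le]
      exact ⟨f, h3.symm⟩
    · intro d hd
      have h1 := Nat.pos_of_mem_divisors hd
      rw [Nat.mem_divisors] at hd
      obtain ⟨⟨c, rfl⟩, -⟩ := hd
      rw [Nat.mul_div_cancel_left _ h1, mem_pairs]
      have := Nat.pos_of_mul_pos_left hn
      refine ⟨by omega, by omega, by push_cast; rfl⟩
    · rintro ⟨e, f⟩ hx
      rw [mem_pairs] at hx
      obtain ⟨h1, h2, h3⟩ := hx
      simp only [Prod.mk.injEq]
      refine ⟨by omega, ?_⟩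
      push_cast
      rw [Int.toNat_of_nonneg h1.le, ← h3, Int.mul_ediv_cancel_left _ h1.ne']
    · intro d _; simp
    · rintro ⟨e, f⟩ hx
      rw [mem_pairs] at hx
      simp only
      omega
  rw [h]
  push_cast
  rfl

lemma sigma1Q_natCast {n : ℕ} (hn : 0 < n) : sigma1Q n = ((∑ x ∈ pairs n, x.1 : ℤ) : ℝ) := by
  rw [sum_pairs_fst hn, sigma1Q, if_pos (by simpa using hn)]
  simp

lemma sigma1Q_of_not_dvd {m d : ℕ} (hd : 0 < d) (h : ¬ d ∣ m) : sigma1Q ((m : ℚ) / d) = 0 := by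
  rw [sigma1Q, if_neg]
  rintro ⟨h1, -⟩
  exact h ((Rat.den_div_natCast_eq_one_iff m d hd.ne').1 h1)

lemma two_mul_sigma1Q_half {m : ℕ} (hm : 0 < m) :
    2 * sigma1Q ((m : ℚ) / 2) =
      ((∑ x ∈ pairs m, (if 2 ∣ x.1 then x.1 else 0) : ℤ) : ℝ) := by
  by_cases h : 2 ∣ m
  · obtain ⟨k, rfl⟩ := h
    have hk : ((2 * k : ℕ) : ℚ) / 2 = (k : ℚ) := by push_cast; ring
    rw [hk, sigma1Q_natCast (by omega), ← Finset.sum_filter]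
    have : ∑ x ∈ pairs (2 * k : ℕ) with 2 ∣ x.1, x.1 = ∑ x ∈ pairs k, 2 * x.1 := by
      refine Finset.sum_nbij' (fun x => (x.1 / 2, x.2)) (fun x => (2 * x.1, x.2)) ?_ ?_ ?_ ?_ ?_
      · rintro ⟨e, f⟩ hx
        rw [Finset.mem_filter, mem_pairs] at hx
        obtain ⟨⟨h1, h2, h3⟩, b, rfl⟩ := hx
        rw [mem_pairs, Int.mul_ediv_cancel_left _ two_ne_zero]
        push_cast at h3
        exact ⟨by omega, h2, by linarith⟩
      · rintro ⟨e, f⟩ hx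
        rw [mem_pairs] at hx
        rw [Finset.mem_filter, mem_pairs]
        push_cast
        exact ⟨⟨by omega, hx.2.1, by linarith [hx.2.2]⟩, by simp⟩
      · rintro ⟨e, f⟩ hx
        rw [Finset.mem_filter] at hx
        simp only [Prod.mk.injEq, and_true] at hx ⊢
        omega
      · rintro ⟨e, f⟩ hx
        simp
      · rintro ⟨e, f⟩ hx
        rw [Finset.mem_filter] at hx
        simp only at hx ⊢
        omega
    rw [this, ← Finset.mul_sum]
    push_cast
    rfl
  · have := sigma1Q_of_not_dvd two_pos h
    push_cast at this
    rw [this, Finset.sum_eq_zero]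
    · simp
    · rintro ⟨e, f⟩ hx
      rw [mem_pairs] at hx
      rw [if_neg]
      rintro ⟨b, hb⟩
      simp only at hb
      apply h
      rw [← Int.natCast_dvd_natCast, ← hx.2.2, hb]
      exact ⟨b * f, by push_cast; ring⟩

lemma two_mul_sigma1Q_quarter {m : ℕ} (hm : 0 < m) :
    2 * sigma1Q ((m : ℚ) / 4) =
      ((∑ x ∈ pairs m, (if 2 ∣ x.1 ∧ 2 ∣ x.2 then x.1 else 0) : ℤ) : ℝ) := by
  by_cases h : 4 ∣ m
  · obtain ⟨k, rfl⟩ := h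
    have hk : ((4 * k : ℕ) : ℚ) / 4 = (k : ℚ) := by push_cast; ring
    rw [hk, sigma1Q_natCast (by omega), ← Finset.sum_filter]
    have : ∑ x ∈ pairs (4 * k : ℕ) with 2 ∣ x.1 ∧ 2 ∣ x.2, x.1 = ∑ x ∈ pairs k, 2 * x.1 := by
      refine Finset.sum_nbij' (fun x => (x.1 / 2, x.2 / 2)) (fun x => (2 * x.1, 2 * x.2))
        ?_ ?_ ?_ ?_ ?_
      · rintro ⟨e, f⟩ hx
        rw [Finset.mem_filter, mem_pairs] at hx
        obtain ⟨⟨h1, h2, h3⟩, ⟨b, rfl⟩, ⟨c, rfl⟩⟩ := hx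
        rw [mem_pairs, Int.mul_ediv_cancel_left _ two_ne_zero,
          Int.mul_ediv_cancel_left _ two_ne_zero]
        push_cast at h3
        exact ⟨by omega, by omega, by linarith⟩
      · rintro ⟨e, f⟩ hx
        rw [mem_pairs] at hx
        rw [Finset.mem_filter, mem_pairs]
        push_cast
        exact ⟨⟨by omega, by omega, by linarith [hx.2.2]⟩, by simp⟩
      · rintro ⟨e, f⟩ hx
        rw [Finset.mem_filter] at hx
        simp only [Prod.mk.injEq] at hx ⊢
        omega
      · rintro ⟨e, f⟩ hx
        simp
      · rintro ⟨e, f⟩ hx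
        rw [Finset.mem_filter] at hx
        simp only at hx ⊢
        omega
    rw [this, ← Finset.mul_sum]
    push_cast
    rfl
  · have := sigma1Q_of_not_dvd four_pos h
    push_cast at this
    rw [this, Finset.sum_eq_zero]
    · simp
    · rintro ⟨e, f⟩ hx
      rw [mem_pairs] at hx
      rw [if_neg]
      rintro ⟨⟨b, hb⟩, ⟨c, hc⟩⟩
      simp only at hb hc
      apply h
      rw [← Int.natCast_dvd_natCast, ← hx.2.2, hb, hc]
      exact ⟨b * c, by push_cast; ring⟩

lemma mem_image_of_hurwitzH_ne_zero {m : ℤ} (hm : 0 < m) {r : ℤ} (hr : Even r)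
    (h : hurwitzH (4 * m - r ^ 2) ≠ 0) :
    r ∈ (Finset.Icc (-(3 * m)) (3 * m)).image (2 * ·) := by
  obtain ⟨s, rfl⟩ := hr
  have h1 : 0 ≤ 4 * m - (s + s) ^ 2 := by
    by_contra! h0
    exact h (hurwitzH_of_neg h0)
  have h2 : s ^ 2 ≤ m := by linarith
  have h3 := Int.le_self_sq s
  have h4 := Int.le_self_sq (-s)
  rw [neg_sq] at h4
  exact Finset.mem_image.2 ⟨s, Finset.mem_Icc.2 (by omega), by ring⟩

theorem statement7 (m : ℕ) (hm : 0 < m) :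
    {r : ℤ | Even r ∧ hurwitzH (4 * (m : ℤ) - r ^ 2) ≠ 0}.Finite ∧
    {p : ℤ × ℤ | p.2 ^ 2 - p.1 ^ 2 = (m : ℤ)}.Finite ∧
    ∑ᶠ r ∈ {r : ℤ | Even r}, hurwitzH (4 * (m : ℤ) - r ^ 2)
      = 4 / 3 * sigma1Q (m : ℚ) - 2 * sigma1Q ((m : ℚ) / 2) + 8 / 3 * sigma1Q ((m : ℚ) / 4)
        - 1 / 2 * ∑ᶠ p ∈ {p : ℤ × ℤ | p.2 ^ 2 - p.1 ^ 2 = (m : ℤ)},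
            ((min |p.1 + p.2| |p.1 - p.2| : ℤ) : ℝ) := by
  have hm' : (0 : ℤ) < m := by exact_mod_cast hm
  refine ⟨?_, ?_, ?_⟩
  · exact (Finset.finite_toSet _).subset fun r hr => mem_image_of_hurwitzH_ne_zero hm' hr.1 hr.2
  · rw [setOf_sq_sub_sq_eq hm']
    exact Finset.finite_toSet _
  rw [finsum_min_abs hm', finsum_mem_eq_sum_of_inter_support_eq
    (t := (Finset.Icc (-(3 * (m : ℤ))) (3 * m)).image (2 * ·))]
  · have h1 := sum_triWt hm'
    have h2 := sum_sq_eq hm'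
    have h3 : 12 * ∑ s ∈ Finset.Icc (-(3 * (m : ℤ))) (3 * m), hurwitzH (4 * m - (2 * s) ^ 2) =
        ((∑ v ∈ sol m, triWt v.2.1 v.2.2.1 v.2.2.2 -
          ∑ s ∈ Finset.Icc (-(3 * (m : ℤ))) (3 * m), (if s ^ 2 = (m : ℤ) then 1
            else 0) : ℤ) : ℝ) := by
      rw [Finset.mul_sum, sum_sol_eq_sum_triples, ← Finset.sum_sub_distrib, Int.cast_sum]
      exact Finset.sum_congr rfl fun s _ => twelve_mul_hurwitzH_sub_sq hm' s
    rw [Finset.sum_image fun a _ b _ h => mul_left_cancel₀ two_ne_zero h]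
    rw [h1, h2, ← Finset.sum_sub_distrib] at h3
    simp only [add_sub_cancel_right] at h3
    rw [Finset.sum_sub_distrib, Finset.sum_add_distrib, Finset.sum_sub_distrib, ← Finset.mul_sum,
      ← Finset.mul_sum, ← Finset.mul_sum, ← Finset.mul_sum, Int.cast_sub, Int.cast_add,
      Int.cast_sub, Int.cast_mul, Int.cast_mul, Int.cast_mul, Int.cast_mul,
      ← sigma1Q_natCast hm, ← two_mul_sigma1Q_half hm, ← two_mul_sigma1Q_quarter hm] at h3
    rw [Int.cast_mul]
    push_cast at h3 ⊢
    linarith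
  · ext r
    simp only [Set.mem_inter_iff, Set.mem_ofPred_eq, Function.mem_support, Finset.mem_coe]
    refine and_congr_left fun h => ⟨fun hr => mem_image_of_hurwitzH_ne_zero hm' hr h, fun hr => ?_⟩
    obtain ⟨s, -, rfl⟩ := Finset.mem_image.1 hr
    exact even_two_mul s
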